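/- Let S_1 ⊆ S_2 ⊆ … ⊆ S_n be a chain of admissible subsets of [±n], let λ be the Young diagram defined by λ_i = |S_{n+1−i}|, and let m = #{i : λ_i = n}. Then in R^C_n one has τ_{S_1}·τ_{S_2}⋯τ_{S_n} = 2^{n−λ_1+m−1}·I(λ)·τ_{{1}}·τ_{{1,2}}⋯τ_{{1,…,n}}. (This is the algebraic form of the type C_n intersection-number formula ⟨τ_{S_1}⋯τ_{S_n}, μ_X⟩ = 2^{n−λ_1+m−1} I(λ).) -/

import Mathlib

open MvPolynomial

/-- The set `[±n]`, realized as `Fin n × Bool`: `(k, true) ↔ k+1` and `(k, false) ↔ −(k+1)`. -/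
abbrev PM (n : ℕ) := Fin n × Bool

/-- Negation on `[±n]`. -/
def negPM {n : ℕ} (p : PM n) : PM n := (p.1, !p.2)

/-- A subset `S ⊆ [±n]` is admissible if it is nonempty and contains no pair `{i, −i}`. -/
def Adm (n : ℕ) (S : Finset (PM n)) : Prop :=
  S.Nonempty ∧ ∀ p ∈ S, negPM p ∉ S

instance (n : ℕ) (S : Finset (PM n)) : Decidable (Adm n S) := by unfold Adm; infer_instance

/-- Index type of the variables: the admissible subsets of `[±n]`. -/
abbrev IdxC (n : ℕ) := {S : Finset (PM n) // Adm n S}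

/-- `ε_k(S) = 1` if `k ∈ S`, `−1` if `−k ∈ S`, and `0` otherwise. -/
def eps (n : ℕ) (k : Fin n) (S : Finset (PM n)) : ℤ :=
  if (k, true) ∈ S then 1 else if (k, false) ∈ S then -1 else 0

/-- Generators of the defining ideal of `R^C_n`: (i) products `τ_S τ_T` for incomparable `S, T`;
(ii) for `k ≠ l`, `Σ_{|S|<n} (ε_k(S)−ε_l(S)) τ_S + Σ_{|S|=n} ((ε_k(S)−ε_l(S))/2) τ_S`;
(iii) for each `k`, `Σ_{|S|<n} 2ε_k(S) τ_S + Σ_{|S|=n} ε_k(S) τ_S`. -/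
def relC (n : ℕ) : Set (MvPolynomial (IdxC n) ℤ) :=
  {p | ∃ S T : IdxC n, ¬ S.1 ⊆ T.1 ∧ ¬ T.1 ⊆ S.1 ∧ p = X S * X T} ∪
  {p | ∃ k l : Fin n, k ≠ l ∧ p =
      (∑ S : IdxC n, if S.1.card < n then C (eps n k S.1 - eps n l S.1) * X S else 0) +
      (∑ S : IdxC n, if S.1.card = n then C ((eps n k S.1 - eps n l S.1) / 2) * X S else 0)} ∪
  {p | ∃ k : Fin n, p =
      (∑ S : IdxC n, if S.1.card < n then C (2 * eps n k S.1) * X S else 0) +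
      (∑ S : IdxC n, if S.1.card = n then C (eps n k S.1) * X S else 0)}

/-- The ring `R^C_n`. -/
abbrev RC (n : ℕ) := MvPolynomial (IdxC n) ℤ ⧸ Ideal.span (relC n)

/-- The class `τ_S ∈ R^C_n` of an admissible subset `S ⊆ [±n]`. -/
noncomputable def tauC (n : ℕ) (S : Finset (PM n)) : RC n :=
  if h : Adm n S then Ideal.Quotient.mk _ (X (⟨S, h⟩ : IdxC n)) else 1

/-- The subset `{1,…,i}` of `[±n]`. -/
def initSegC (n i : ℕ) : Finset (PM n) :=
  Finset.univ.filter (fun p : PM n => p.2 = true ∧ (p.1 : ℕ) < i)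

/-- The class of a point: `τ_{{1}} ⋯ τ_{{1,…,n}}`. -/
noncomputable def ptC (n : ℕ) : RC n := ∏ i ∈ Finset.Icc 1 n, tauC n (initSegC n i)


/-- `λ_i` extended by `0` for `i > n`. -/
def lamE (n : ℕ) (lam : ℕ → ℕ) (i : ℕ) : ℕ := if i ≤ n then lam i else 0

/-- The sorted list `i_1 < … < i_s` of lower-right corners of `λ`. -/
def cornerL (n : ℕ) (lam : ℕ → ℕ) : List ℕ :=
  ((Finset.Icc 1 n).filter (fun i => lamE n lam (i + 1) < lamE n lam i)).sort (· ≤ ·)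

/-- The number `s` of lower-right corners of `λ`. -/
def sC (n : ℕ) (lam : ℕ → ℕ) : ℕ := (cornerL n lam).length

/-- `i_r` (with `i_0 = 0`; out-of-range indices default to `n+1`, where `λ` vanishes). -/
def iC (n : ℕ) (lam : ℕ → ℕ) (r : ℕ) : ℕ :=
  if r = 0 then 0 else (cornerL n lam).getD (r - 1) (n + 1)

/-- `a_r = i_r − i_{r−1} − 1`. -/
def aC (n : ℕ) (lam : ℕ → ℕ) (r : ℕ) : ℤ := (iC n lam r : ℤ) - iC n lam (r - 1) - 1

/-- `b_r = λ_{i_r} − λ_{i_{r+1}} − 1` (with `λ_{i_{s+1}} = 0`). -/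
def bC (n : ℕ) (lam : ℕ → ℕ) (r : ℕ) : ℤ :=
  (lamE n lam (iC n lam r) : ℤ) - lamE n lam (iC n lam (r + 1)) - 1

/-- `c_r = λ_{i_r} + i_r − n − 1`. -/
def cC (n : ℕ) (lam : ℕ → ℕ) (r : ℕ) : ℤ :=
  (lamE n lam (iC n lam r) : ℤ) + iC n lam r - n - 1

/-- Binomial coefficient `C(x,y)` with `C(x,y) = 0` unless `0 ≤ y ≤ x`. -/
def Cb (x y : ℤ) : ℤ := if 0 ≤ y ∧ y ≤ x then (x.toNat.choose y.toNat : ℤ) else 0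

/-- `y_r = C(a_r, c_r) · C(b_r, c_r)`. -/
def yC (n : ℕ) (lam : ℕ → ℕ) (r : ℕ) : ℤ :=
  Cb (aC n lam r) (cC n lam r) * Cb (bC n lam r) (cC n lam r)

/-- `I(λ) = (−1)^{n+s} y_1 ⋯ y_s`. -/
def IY (n : ℕ) (lam : ℕ → ℕ) : ℤ :=
  (-1) ^ (n + sC n lam) * ∏ r ∈ Finset.Icc 1 (sC n lam), yC n lam r

/-- The value `ε_p(S)` for a signed index `p`, so that `ε_{-p} = -ε_p` on admissible sets. -/
def signedEps {n : ℕ} (p : PM n) (S : Finset (PM n)) : ℤ :=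
  if p ∈ S then 1 else if negPM p ∈ S then -1 else 0

/-- The pairing of the root `t_p - t_q` with the coweight of `S`. -/
def rootCoeff {n : ℕ} (p q : PM n) (S : Finset (PM n)) : ℤ :=
  if S.card < n then signedEps p S - signedEps q S else (signedEps p S - signedEps q S) / 2

@[simp] theorem negPM_negPM {n : ℕ} (p : PM n) : negPM (negPM p) = p := by
  simp [negPM]

theorem negPM_ne {n : ℕ} (p : PM n) : negPM p ≠ p := by
  intro h
  have := congrArg Prod.snd h
  simp [negPM] at this

theorem eq_or_eq_negPM {n : ℕ} {p q : PM n} (h : p.1 = q.1) : p = q ∨ p = negPM q := by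
  obtain ⟨k, b⟩ := p
  obtain ⟨l, c⟩ := q
  cases b <;> cases c <;> simp_all [negPM]

theorem Adm.injOn_fst {n : ℕ} {S : Finset (PM n)} (h : Adm n S) :
    Set.InjOn Prod.fst (S : Set (PM n)) := by
  intro p hp q hq hpq
  rcases eq_or_eq_negPM hpq with h1 | h1
  · exact h1
  · exact absurd (h1 ▸ hp) (h.2 q hq)

theorem Adm.card_image_fst {n : ℕ} {S : Finset (PM n)} (h : Adm n S) :
    (S.image Prod.fst).card = S.card :=
  Finset.card_image_of_injOn h.injOn_fst

theorem Adm.card_le {n : ℕ} {S : Finset (PM n)} (h : Adm n S) : S.card ≤ n := by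
  rw [← h.card_image_fst]
  simpa using Finset.card_le_univ (S.image Prod.fst)

theorem Adm.mem_or_of_card_eq {n : ℕ} {S : Finset (PM n)} (h : Adm n S) (hc : S.card = n)
    (p : PM n) : p ∈ S ∨ negPM p ∈ S := by
  have h1 : S.image Prod.fst = Finset.univ := by
    apply Finset.eq_univ_of_card
    rw [h.card_image_fst, hc, Fintype.card_fin]
  have h2 : p.1 ∈ S.image Prod.fst := by simp [h1]
  obtain ⟨q, hq, hqp⟩ := Finset.mem_image.1 h2
  rcases eq_or_eq_negPM hqp with h3 | h3
  · exact Or.inl (h3 ▸ hq)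
  · exact Or.inr (h3 ▸ hq)

theorem Adm.exists_of_card_lt {n : ℕ} {S : Finset (PM n)} (h : Adm n S) (hc : S.card < n) :
    ∃ p : PM n, p ∉ S ∧ negPM p ∉ S := by
  by_contra! hcon
  have h1 : S.image Prod.fst = Finset.univ := by
    ext k
    simp only [Finset.mem_image, Finset.mem_univ, iff_true]
    by_cases hk : (k, true) ∈ S
    · exact ⟨_, hk, rfl⟩
    · exact ⟨_, hcon _ hk, rfl⟩
  have h2 := h.card_image_fst
  rw [h1, Finset.card_univ, Fintype.card_fin] at h2
  omega

theorem Adm.subset {n : ℕ} {S T : Finset (PM n)} (hT : Adm n T) (h : S ⊆ T)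
    (hS : S.Nonempty) : Adm n S :=
  ⟨hS, fun p hp hn => hT.2 p (h hp) (h hn)⟩

theorem Adm.insert {n : ℕ} {S : Finset (PM n)} (hS : Adm n S) {p : PM n}
    (hp : negPM p ∉ S) : Adm n (insert p S) := by
  refine ⟨Finset.insert_nonempty _ _, fun q hq hn => ?_⟩
  rw [Finset.mem_insert] at hq hn
  rcases hq with rfl | hq
  · rcases hn with h | h
    · exact negPM_ne _ h
    · exact hp h
  · rcases hn with h | h
    · subst h
      simp only [negPM_negPM] at hp
      exact hp hq
    · exact hS.2 q hq h

theorem tauC_val {n : ℕ} (S : IdxC n) :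
    tauC n S.1 = Ideal.Quotient.mk (Ideal.span (relC n)) (X S) := by
  simp [tauC, S.2]

theorem tauC_mul_tauC_of_incomparable {n : ℕ} {S T : Finset (PM n)} (hS : Adm n S)
    (hT : Adm n T) (h1 : ¬ S ⊆ T) (h2 : ¬ T ⊆ S) : tauC n S * tauC n T = 0 := by
  have hs := tauC_val ⟨S, hS⟩
  have ht := tauC_val ⟨T, hT⟩
  simp only at hs ht
  rw [hs, ht, ← map_mul, Ideal.Quotient.eq_zero_iff_mem]
  exact Ideal.subset_span (Or.inl (Or.inl ⟨⟨S, hS⟩, ⟨T, hT⟩, h1, h2, rfl⟩))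

theorem signedEps_true {n : ℕ} (k : Fin n) (S : Finset (PM n)) :
    signedEps (k, true) S = eps n k S := by
  simp [signedEps, eps, negPM]

theorem signedEps_negPM {n : ℕ} (p : PM n) {S : Finset (PM n)} (h : Adm n S) :
    signedEps (negPM p) S = - signedEps p S := by
  have := h.2 p
  by_cases h1 : p ∈ S <;> by_cases h2 : negPM p ∈ S <;> simp_all [signedEps]

theorem signedEps_false {n : ℕ} (k : Fin n) {S : Finset (PM n)} (h : Adm n S) :
    signedEps (k, false) S = - eps n k S := by
  rw [← signedEps_true, ← signedEps_negPM _ h]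
  simp [negPM]

theorem sum_sub_relation {n : ℕ} (k l : Fin n) :
    ∑ S : IdxC n, ((if S.1.card < n then eps n k S.1 - eps n l S.1
      else (eps n k S.1 - eps n l S.1) / 2 : ℤ) : RC n) * tauC n S.1 = 0 := by
  by_cases hkl : k = l
  · subst hkl
    simp
  have h : Ideal.Quotient.mk (Ideal.span (relC n)) _ = 0 :=
    Ideal.Quotient.eq_zero_iff_mem.2 (Ideal.subset_span (Or.inl (Or.inr ⟨k, l, hkl, rfl⟩)))
  rw [← Finset.sum_add_distrib, map_sum] at h
  rw [← h]
  refine Finset.sum_congr rfl fun S _ => ?_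
  have hc := S.2.card_le
  rw [tauC_val]
  split_ifs with h1 h2 h2
  · omega
  · simp
  · simp
  · omega

theorem sum_double_relation {n : ℕ} (k : Fin n) :
    ∑ S : IdxC n, ((if S.1.card < n then 2 * eps n k S.1
      else eps n k S.1 : ℤ) : RC n) * tauC n S.1 = 0 := by
  have h : Ideal.Quotient.mk (Ideal.span (relC n)) _ = 0 :=
    Ideal.Quotient.eq_zero_iff_mem.2 (Ideal.subset_span (Or.inr ⟨k, rfl⟩))
  rw [← Finset.sum_add_distrib, map_sum] at h
  rw [← h]
  refine Finset.sum_congr rfl fun S _ => ?_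
  have hc := S.2.card_le
  rw [tauC_val]
  split_ifs with h1 h2 h2
  · omega
  · simp [map_ofNat (Ideal.Quotient.mk (Ideal.span (relC n))) 2]
  · simp
  · omega

theorem sum_rootCoeff_mul_tauC {n : ℕ} (p q : PM n) :
    ∑ S : IdxC n, (rootCoeff p q S.1 : RC n) * tauC n S.1 = 0 := by
  obtain ⟨k, b⟩ := p
  obtain ⟨l, c⟩ := q
  cases b <;> cases c
  · rw [← sum_sub_relation l k]
    refine Finset.sum_congr rfl fun S _ => ?_
    congr 2
    rw [rootCoeff, signedEps_false _ S.2, signedEps_false _ S.2]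
    split_ifs <;> ring_nf
  · rw [← sub_zero (0 : RC n)]
    nth_rw 1 [← sum_sub_relation k l]
    rw [← sum_double_relation k, ← Finset.sum_sub_distrib]
    refine Finset.sum_congr rfl fun S _ => ?_
    rw [← sub_mul, ← Int.cast_sub]
    congr 2
    rw [rootCoeff, signedEps_false _ S.2, signedEps_true]
    split_ifs <;> omega
  · rw [← add_zero (0 : RC n)]
    nth_rw 1 [← sum_sub_relation k l]
    rw [← sum_double_relation l, ← Finset.sum_add_distrib]
    refine Finset.sum_congr rfl fun S _ => ?_
    rw [← add_mul, ← Int.cast_add]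
    congr 2
    rw [rootCoeff, signedEps_false _ S.2, signedEps_true]
    split_ifs <;> omega
  · rw [← sum_sub_relation k l]
    refine Finset.sum_congr rfl fun S _ => ?_
    rw [rootCoeff, signedEps_true, signedEps_true]

theorem prod_tauC_update {n : ℕ} (F : ℕ → Finset (PM n)) {j : ℕ} (hj : j ∈ Finset.Icc 1 n)
    (A : Finset (PM n)) :
    ∏ k ∈ Finset.Icc 1 n, tauC n (Function.update F j A k) =
      (∏ k ∈ (Finset.Icc 1 n).erase j, tauC n (F k)) * tauC n A := by
  rw [← Finset.prod_erase_mul _ _ hj]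
  congr 1
  · refine Finset.prod_congr rfl fun k hk => ?_
    rw [Function.update_of_ne (Finset.ne_of_mem_erase hk)]
  · simp

theorem prod_erase_mul_tauC_eq_zero {n : ℕ} {F : ℕ → Finset (PM n)} {j k : ℕ}
    (hk : k ∈ Finset.Icc 1 n) (hkj : k ≠ j) {A : Finset (PM n)} (hA : Adm n A)
    (hF : Adm n (F k)) (h1 : ¬ A ⊆ F k) (h2 : ¬ F k ⊆ A) :
    (∏ k ∈ (Finset.Icc 1 n).erase j, tauC n (F k)) * tauC n A = 0 := by
  rw [← Finset.prod_erase_mul _ _ (Finset.mem_erase.2 ⟨hkj, hk⟩), mul_assoc,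
    tauC_mul_tauC_of_incomparable hF hA h2 h1, mul_zero]

theorem prod_update_eq_of_rootCoeff {n : ℕ} (F : ℕ → Finset (PM n)) {j : ℕ}
    (hj : j ∈ Finset.Icc 1 n) (hF : ∀ k ∈ Finset.Icc 1 n, k ≠ j → Adm n (F k))
    (A B : IdxC n) (p q : PM n) (hA : rootCoeff p q A.1 = 1) (hB : rootCoeff p q B.1 = -1)
    (h : ∀ X : IdxC n, X ≠ A → X ≠ B → rootCoeff p q X.1 ≠ 0 →
      ∃ k ∈ Finset.Icc 1 n, k ≠ j ∧ ¬ X.1 ⊆ F k ∧ ¬ F k ⊆ X.1) :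
    ∏ k ∈ Finset.Icc 1 n, tauC n (Function.update F j A.1 k) =
      ∏ k ∈ Finset.Icc 1 n, tauC n (Function.update F j B.1 k) := by
  rw [prod_tauC_update F hj, prod_tauC_update F hj]
  set Q := ∏ k ∈ (Finset.Icc 1 n).erase j, tauC n (F k) with hQ
  have hAB : A ≠ B := by
    rintro rfl
    omega
  have h0 := congrArg (Q * ·) (sum_rootCoeff_mul_tauC p q)
  simp only [Finset.mul_sum, mul_zero] at h0
  rw [Finset.sum_eq_add A B hAB (fun X _ hX => ?_) (by simp) (by simp), hA, hB] at h0
  · push_cast at h0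
    linear_combination h0
  · by_cases hc : rootCoeff p q X.1 = 0
    · simp [hc]
    · obtain ⟨k, hk, hkj, h1, h2⟩ := h X hX.1 hX.2 hc
      rw [mul_left_comm, hQ,
        prod_erase_mul_tauC_eq_zero hk hkj X.2 (hF k hk hkj) h1 h2, mul_zero]

theorem rootCoeff_eq_zero_of_notMem {n : ℕ} {p q : PM n} {S : Finset (PM n)} (h1 : p ∉ S)
    (h2 : negPM p ∉ S) (h3 : q ∉ S) (h4 : negPM q ∉ S) : rootCoeff p q S = 0 := by
  simp [rootCoeff, signedEps, h1, h2, h3, h4]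

/-- Exchanging two consecutive elements of a flag does not change the product of its classes. -/
theorem prod_update_insert_comm {n : ℕ} (F : ℕ → Finset (PM n)) {j : ℕ} (hj : 1 ≤ j) (hjn : j < n)
    (hF : ∀ k ∈ Finset.Icc 1 n, Adm n (F k)) (hF0 : F 0 = ∅) {p q : PM n}
    (hp : p ∉ F (j - 1)) (hq : q ∉ F (j - 1)) (hpq : p ≠ q)
    (hins : F (j + 1) = insert p (insert q (F (j - 1)))) (hcard : (F (j - 1)).card < n - 1) :
    ∏ k ∈ Finset.Icc 1 n, tauC n (Function.update F j (insert p (F (j - 1))) k) =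
      ∏ k ∈ Finset.Icc 1 n, tauC n (Function.update F j (insert q (F (j - 1))) k) := by
  have hadm := hF (j + 1) (by simp; omega)
  have hnp : negPM p ∉ F (j + 1) := hadm.2 p (by simp [hins])
  have hnq : negPM q ∉ F (j + 1) := hadm.2 q (by simp [hins])
  have hsub : F (j - 1) ⊆ F (j + 1) := by
    rw [hins]
    exact (Finset.subset_insert _ _).trans (Finset.subset_insert _ _)
  have hnp' := fun h => hnp (hsub h)
  have hnq' := fun h => hnq (hsub h)
  have hsA : insert p (F (j - 1)) ⊆ F (j + 1) := Finset.insert_subset (by simp [hins]) hsub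
  have hsB : insert q (F (j - 1)) ⊆ F (j + 1) := Finset.insert_subset (by simp [hins]) hsub
  have hA : Adm n (insert p (F (j - 1))) := hadm.subset hsA (Finset.insert_nonempty _ _)
  have hB : Adm n (insert q (F (j - 1))) := hadm.subset hsB (Finset.insert_nonempty _ _)
  have hnA : negPM q ∉ insert p (F (j - 1)) := fun h => hnq (hsA h)
  have hnB : negPM p ∉ insert q (F (j - 1)) := fun h => hnp (hsB h)
  refine prod_update_eq_of_rootCoeff F (by simp; omega) (fun k hk _ => hF k hk)
    ⟨_, hA⟩ ⟨_, hB⟩ p q ?_ ?_ ?_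
  · have hc : (insert p (F (j - 1))).card < n := by
      rw [Finset.card_insert_of_notMem hp]
      omega
    have hqA : q ∉ insert p (F (j - 1)) := by simp [hq, hpq.symm]
    simp only [rootCoeff, hc, signedEps, hqA, hnA]
    simp
  · have hc : (insert q (F (j - 1))).card < n := by
      rw [Finset.card_insert_of_notMem hq]
      omega
    have hpB : p ∉ insert q (F (j - 1)) := by simp [hp, hpq]
    simp only [rootCoeff, hc, signedEps, hpB, hnB]
    simp
  · rintro ⟨X, hX⟩ hXA hXB hc
    simp only [ne_eq, Subtype.mk.injEq] at hXA hXB hc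
    by_contra! hcon
    have hup : X ⊆ F (j + 1) := by
      by_contra hno
      have h1 := hcon (j + 1) (by simp; omega) (by omega) hno
      have hpX : p ∈ X := h1 (by simp [hins])
      have hqX : q ∈ X := h1 (by simp [hins])
      simp [rootCoeff, signedEps, hpX, hqX] at hc
    have hlow : F (j - 1) ⊆ X := by
      by_cases hj1 : j = 1
      · simp [hj1, hF0]
      by_contra hno
      have h1 : X ⊆ F (j - 1) := by
        by_contra h
        exact hno (hcon (j - 1) (by simp; omega) (by omega) h)
      exact hc (rootCoeff_eq_zero_of_notMem (fun h => hp (h1 h)) (fun h => hnp' (h1 h))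
        (fun h => hq (h1 h)) (fun h => hnq' (h1 h)))
    have hnpX := fun h => hnp (hup h)
    have hnqX := fun h => hnq (hup h)
    rw [hins] at hup
    by_cases hpX : p ∈ X <;> by_cases hqX : q ∈ X
    · simp [rootCoeff, signedEps, hpX, hqX] at hc
    · refine hXA (Finset.Subset.antisymm (fun x hx => ?_) (Finset.insert_subset hpX hlow))
      have := hup hx
      simp only [Finset.mem_insert] at this ⊢
      rcases this with h | rfl | h
      · exact Or.inl h
      · exact absurd hx hqX
      · exact Or.inr h
    · refine hXB (Finset.Subset.antisymm (fun x hx => ?_) (Finset.insert_subset hqX hlow))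
      have := hup hx
      simp only [Finset.mem_insert] at this ⊢
      rcases this with rfl | h | h
      · exact absurd hx hpX
      · exact Or.inl h
      · exact Or.inr h
    · exact hc (rootCoeff_eq_zero_of_notMem hpX hnpX hqX hnqX)

/-- Changing the sign of the last element of a flag does not change the product of its classes. -/
theorem prod_update_insert_negPM {n : ℕ} (hn : 1 ≤ n) (F : ℕ → Finset (PM n))
    (hF : ∀ k ∈ Finset.Icc 1 n, Adm n (F k)) (hF0 : F 0 = ∅) {p : PM n}
    (hp : p ∉ F (n - 1)) (hnp : negPM p ∉ F (n - 1)) (hcard : (F (n - 1)).card = n - 1) :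
    ∏ k ∈ Finset.Icc 1 n, tauC n (Function.update F n (insert p (F (n - 1))) k) =
      ∏ k ∈ Finset.Icc 1 n, tauC n (Function.update F n (insert (negPM p) (F (n - 1))) k) := by
  have key : ∀ q : PM n, negPM q ∉ F (n - 1) → Adm n (insert q (F (n - 1))) := by
    intro q hq
    by_cases h1 : n = 1
    · have h0 : F (n - 1) = ∅ := by simp [h1, hF0]
      rw [h0]
      exact ⟨by simp, by simpa using negPM_ne q⟩
    · exact (hF (n - 1) (by simp; omega)).insert hq
  have hA := key p hnp
  have hB := key (negPM p) (by simpa using hp)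
  have hcA : (insert p (F (n - 1))).card = n := by
    rw [Finset.card_insert_of_notMem hp]
    omega
  have hcB : (insert (negPM p) (F (n - 1))).card = n := by
    rw [Finset.card_insert_of_notMem hnp]
    omega
  refine prod_update_eq_of_rootCoeff F (by simp; omega) (fun k hk _ => hF k hk)
    ⟨_, hA⟩ ⟨_, hB⟩ p (negPM p) ?_ ?_ ?_
  · simp [rootCoeff, signedEps_negPM p hA, hcA]
    simp [signedEps]
  · have h := hB.2 (negPM p) (by simp)
    rw [negPM_negPM] at h
    simp [rootCoeff, signedEps_negPM p hB, hcB]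
    simp [signedEps, h]
  · rintro ⟨X, hX⟩ hXA hXB hc
    simp only [ne_eq, Subtype.mk.injEq] at hXA hXB hc
    by_contra! hcon
    have hlow : F (n - 1) ⊆ X := by
      by_cases hj1 : n = 1
      · simp [hj1, hF0]
      by_contra hno
      have h1 : X ⊆ F (n - 1) := by
        by_contra h
        exact hno (hcon (n - 1) (by simp; omega) (by omega) h)
      exact hc (rootCoeff_eq_zero_of_notMem (fun h => hp (h1 h)) (fun h => hnp (h1 h))
        (fun h => hnp (h1 h)) (fun h => hp (h1 (by simpa using h))))
    by_cases h1 : p ∈ X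
    · exact hXA (Finset.eq_of_subset_of_card_le (Finset.insert_subset h1 hlow)
        (hX.card_le.trans hcA.ge)).symm
    by_cases h2 : negPM p ∈ X
    · exact hXB (Finset.eq_of_subset_of_card_le (Finset.insert_subset h2 hlow)
        (hX.card_le.trans hcB.ge)).symm
    · exact hc (rootCoeff_eq_zero_of_notMem h1 h2 h2 (by simpa using h1))

/-- The `k`-th set of the flag associated with the signed permutation `(σ, ε)`. -/
def permSeg {n : ℕ} (σ : Equiv.Perm (Fin n)) (ε : Fin n → Bool) (k : ℕ) : Finset (PM n) :=
  Finset.univ.filter fun p => p.2 = ε p.1 ∧ (σ.symm p.1 : ℕ) < k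

theorem mem_permSeg {n : ℕ} {σ : Equiv.Perm (Fin n)} {ε : Fin n → Bool} {k : ℕ} {p : PM n} :
    p ∈ permSeg σ ε k ↔ p.2 = ε p.1 ∧ (σ.symm p.1 : ℕ) < k := by
  simp [permSeg]

theorem adm_permSeg {n : ℕ} (σ : Equiv.Perm (Fin n)) (ε : Fin n → Bool) {k : ℕ}
    (hk : k ∈ Finset.Icc 1 n) : Adm n (permSeg σ ε k) := by
  rw [Finset.mem_Icc] at hk
  refine ⟨⟨(σ ⟨0, by omega⟩, ε (σ ⟨0, by omega⟩)), ?_⟩, fun p hp hn => ?_⟩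
  · rw [mem_permSeg]
    simp
    omega
  · rw [mem_permSeg] at hp hn
    simp [negPM, hp.1] at hn

theorem permSeg_zero {n : ℕ} (σ : Equiv.Perm (Fin n)) (ε : Fin n → Bool) :
    permSeg σ ε 0 = ∅ := by
  simp [permSeg]

theorem permSeg_succ {n : ℕ} (σ : Equiv.Perm (Fin n)) (ε : Fin n → Bool) (i : Fin n) :
    permSeg σ ε (i + 1) = insert (σ i, ε (σ i)) (permSeg σ ε i) := by
  ext ⟨x, b⟩
  rw [Finset.mem_insert, mem_permSeg, mem_permSeg, Prod.mk.injEq]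
  simp only
  constructor
  · rintro ⟨h1, h2⟩
    by_cases h3 : σ.symm x = i
    · left
      simp [← h3, h1]
    · right
      refine ⟨h1, ?_⟩
      have : (σ.symm x : ℕ) ≠ i := fun h => h3 (Fin.ext h)
      omega
  · rintro (⟨h1, h2⟩ | ⟨h1, h2⟩)
    · subst h1
      simp [h2]
    · exact ⟨h1, by omega⟩

theorem notMem_permSeg {n : ℕ} (σ : Equiv.Perm (Fin n)) (ε : Fin n → Bool) {i : Fin n} {k : ℕ}
    (h : k ≤ i) (b : Bool) : (σ i, b) ∉ permSeg σ ε k := by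
  rw [mem_permSeg]
  simp
  omega

theorem card_permSeg {n : ℕ} (σ : Equiv.Perm (Fin n)) (ε : Fin n → Bool) {k : ℕ} (hk : k ≤ n) :
    (permSeg σ ε k).card = k := by
  induction k with
  | zero => simp [permSeg_zero]
  | succ k ih =>
    rw [permSeg_succ σ ε ⟨k, hk⟩, Finset.card_insert_of_notMem (notMem_permSeg _ _ le_rfl _),
      ih (by omega)]

/-- The product of the classes of the flag associated with a signed permutation. -/
noncomputable def permProd {n : ℕ} (σ : Equiv.Perm (Fin n)) (ε : Fin n → Bool) : RC n :=
  ∏ k ∈ Finset.Icc 1 n, tauC n (permSeg σ ε k)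

theorem permProd_mul_swap {n : ℕ} (σ : Equiv.Perm (Fin n)) (ε : Fin n → Bool) {i j : Fin n}
    (hij : (j : ℕ) = i + 1) : permProd (σ * Equiv.swap i j) ε = permProd σ ε := by
  have hj := j.2
  have hne : i ≠ j := by
    rintro rfl
    omega
  have hseg : ∀ k : ℕ, k ≠ i + 1 → permSeg (σ * Equiv.swap i j) ε k = permSeg σ ε k := by
    intro k hk
    ext p
    rw [mem_permSeg, mem_permSeg]
    have hinv : (σ * Equiv.swap i j).symm p.1 = Equiv.swap i j (σ.symm p.1) := by
      simp [Equiv.Perm.mul_def]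
    rw [hinv, Equiv.swap_apply_def]
    split_ifs with h1 h2
    · rw [h1]
      exact and_congr_right fun _ => by omega
    · rw [h2]
      exact and_congr_right fun _ => by omega
    · rfl
  have h1 := prod_update_insert_comm (permSeg σ ε) (j := i + 1) (by omega) (by omega)
    (fun k hk => adm_permSeg σ ε hk) (permSeg_zero _ _) (p := (σ i, ε (σ i)))
    (q := (σ j, ε (σ j))) (notMem_permSeg _ _ (by simp) _)
    (notMem_permSeg _ _ (by simp; omega) _) (by simp [hne])
    (by rw [← hij, permSeg_succ, Finset.insert_comm, hij, permSeg_succ]; simp)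
    (by simp [card_permSeg]; omega)
  rw [permProd, permProd]
  convert h1.symm using 2 with k hk k hk
  · by_cases hki : k = i + 1
    · subst hki
      rw [Function.update_self, permSeg_succ]
      simp [hseg]
    · rw [Function.update_of_ne hki, hseg k hki]
  · by_cases hki : k = i + 1
    · subst hki
      rw [Function.update_self, permSeg_succ]
      simp
    · rw [Function.update_of_ne hki]

theorem permProd_mul {n : ℕ} (σ π : Equiv.Perm (Fin n)) (ε : Fin n → Bool) :
    permProd (σ * π) ε = permProd σ ε := by
  cases n with
  | zero => rw [Subsingleton.elim (σ * π) σ]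
  | succ m =>
    have hπ : π ∈ Submonoid.closure
        (Set.range fun i : Fin m => Equiv.swap i.castSucc i.succ) := by
      rw [Equiv.Perm.mclosure_swap_castSucc_succ]
      trivial
    induction hπ using Submonoid.closure_induction generalizing σ with
    | mem x hx =>
      obtain ⟨i, rfl⟩ := hx
      exact permProd_mul_swap σ ε (by simp)
    | one => simp
    | mul x y _ _ hx hy => rw [← mul_assoc, hy, hx]

theorem permProd_eq_one {n : ℕ} (σ : Equiv.Perm (Fin n)) (ε : Fin n → Bool) :
    permProd σ ε = permProd 1 ε := by
  simpa using permProd_mul 1 σ ε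

theorem permProd_update {n : ℕ} (ε : Fin n → Bool) (x : Fin n) :
    permProd 1 (Function.update ε x (!ε x)) = permProd 1 ε := by
  have hn : 0 < n := Fin.pos x
  set l : Fin n := ⟨n - 1, by omega⟩ with hl
  set σ : Equiv.Perm (Fin n) := Equiv.swap l x with hσ
  have hσl : σ l = x := by simp [hσ]
  rw [← permProd_eq_one σ, ← permProd_eq_one σ ε]
  have h1 := prod_update_insert_negPM hn (permSeg σ ε) (fun k hk => adm_permSeg σ ε hk)
    (permSeg_zero _ _) (p := (σ l, ε (σ l))) (notMem_permSeg _ _ (by simp [hl]) _)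
    (notMem_permSeg _ _ (by simp [hl]) _) (card_permSeg _ _ (by omega))
  have hseg : ∀ k : ℕ, k < n →
      permSeg σ (Function.update ε x (!ε x)) k = permSeg σ ε k := by
    intro k hk
    ext p
    rw [mem_permSeg, mem_permSeg]
    by_cases hp : p.1 = x
    · have : σ.symm p.1 = l := by rw [hp, ← hσl, Equiv.symm_apply_apply]
      rw [this]
      simp [hl]
      omega
    · rw [Function.update_of_ne hp]
  have hlast : ∀ ε' : Fin n → Bool,
      permSeg σ ε' n = insert (σ l, ε' (σ l)) (permSeg σ ε' (n - 1)) := by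
    intro ε'
    rw [← permSeg_succ]
    congr
    simp [hl]
    omega
  rw [permProd, permProd]
  convert h1.symm using 2 with k hk k hk
  · by_cases hki : k = n
    · subst hki
      rw [Function.update_self, hlast, hseg _ (by omega)]
      simp [hσl, negPM]
    · rw [Function.update_of_ne hki, hseg k]
      have := Finset.mem_Icc.1 hk
      omega
  · by_cases hki : k = n
    · subst hki
      rw [Function.update_self, hlast]
    · rw [Function.update_of_ne hki]

theorem permProd_eq_ptC {n : ℕ} (σ : Equiv.Perm (Fin n)) (ε : Fin n → Bool) :
    permProd σ ε = ptC n := by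
  rw [permProd_eq_one]
  have key : ∀ (A : Finset (Fin n)) (ε : Fin n → Bool), (∀ x, ε x = false ↔ x ∈ A) →
      permProd 1 ε = ptC n := by
    intro A
    induction A using Finset.induction_on with
    | empty =>
      intro ε h
      have : ∀ x, ε x = true := by simpa using h
      simp only [permProd, ptC, permSeg, initSegC, this]
      rfl
    | insert x A hx ih =>
      intro ε h
      rw [← permProd_update ε x]
      have hεx : ε x = false := (h x).2 (by simp)
      apply ih
      intro y
      by_cases hy : y = x
      · subst hy
        simp [hεx, hx]
      · simp [hy, h y]
  exact key (Finset.univ.filter fun x => ε x = false) ε (by simp)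

theorem prod_tauC_eq_ptC {n : ℕ} (S : ℕ → Finset (PM n)) (hadm : ∀ k ∈ Finset.Icc 1 n, Adm n (S k))
    (hmono : ∀ i j, i ≤ j → j ≤ n → S i ⊆ S j) (hcard : ∀ k ≤ n, (S k).card = k) :
    ∏ k ∈ Finset.Icc 1 n, tauC n (S k) = ptC n := by
  have hg : ∀ i : Fin n, ∃ p, p ∉ S i ∧ insert p (S i) = S (i + 1) := by
    intro i
    have h := i.2
    have h1 := Finset.exists_eq_insert_iff.2 (⟨hmono i (i + 1) (by omega) (by omega), by
      rw [hcard i (by omega), hcard (i + 1) (by omega)]⟩ :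
        S i ⊆ S (i + 1) ∧ (S i).card + 1 = (S (i + 1)).card)
    simpa using h1
  choose g hg1 hg2 using hg
  have hgmem : ∀ i : Fin n, g i ∈ S (i + 1) := fun i => by simp [← hg2 i]
  have hgn : ∀ i : Fin n, g i ∈ S n := fun i => hmono _ _ i.2 le_rfl (hgmem i)
  have hlt : ∀ i j : Fin n, i < j → g i ≠ g j := fun i j hij h =>
    hg1 j (h ▸ hmono _ _ hij j.2.le (hgmem i))
  have hginj : Function.Injective g := by
    intro i j h
    rcases lt_trichotomy i j with h1 | h1 | h1
    · exact absurd h (hlt _ _ h1)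
    · exact h1
    · exact absurd h.symm (hlt _ _ h1)
  have hfinj : Function.Injective fun i => (g i).1 := by
    intro i j h
    have hn : 0 < n := Fin.pos i
    exact hginj ((hadm n (by simp; omega)).injOn_fst (hgn i) (hgn j) h)
  set σ : Equiv.Perm (Fin n) := Equiv.ofBijective _ (Finite.injective_iff_bijective.1 hfinj)
    with hσ
  have hσ1 : ∀ i, σ i = (g i).1 := fun i => rfl
  have hseg : ∀ k ≤ n, S k = permSeg σ (fun x => (g (σ.symm x)).2) k := by
    intro k
    induction k with
    | zero =>
      intro _
      rw [permSeg_zero, ← Finset.card_eq_zero, hcard 0 (by omega)]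
    | succ k ih =>
      intro hk
      rw [permSeg_succ _ _ ⟨k, hk⟩, ← ih (by omega), ← hg2 ⟨k, hk⟩,
        Equiv.symm_apply_apply]
      rfl
  rw [← permProd_eq_ptC σ fun x => (g (σ.symm x)).2, permProd]
  exact Finset.prod_congr rfl fun k hk => by rw [← hseg k (Finset.mem_Icc.1 hk).2]

/-- The number of later terms of `s` equal to its `k`-th term. -/
def laterCount (n : ℕ) (s : ℕ → ℕ) (k : ℕ) : ℕ :=
  ((Finset.Ioc k n).filter fun l => s l = s k).card

/-- The factor of the intersection number contributed by the index `k` of the size sequence `s`. -/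
def sizeFactor (n : ℕ) (s : ℕ → ℕ) (k : ℕ) : ℤ :=
  if s (k - 1) = s k then -1
  else Cb (laterCount n s k) ((s k : ℤ) - k) * Cb ((s k : ℤ) - s (k - 1) - 1) ((s k : ℤ) - k)

/-- The exponent of `2` in the intersection number. -/
def twoExp (n : ℕ) (s : ℕ → ℕ) : ℕ :=
  n - s n + ((Finset.Icc 1 n).filter fun k => s k = n).card - 1

/-- The intersection number attached to the size sequence `s`. -/
def sizeNumber (n : ℕ) (s : ℕ → ℕ) : ℤ :=
  2 ^ twoExp n s * ∏ k ∈ Finset.Icc 1 n, sizeFactor n s k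

/-- The indices `i < j` bound a maximal block on which the size sequence `s` is constant. -/
structure IsBlock (n : ℕ) (s : ℕ → ℕ) (i j : ℕ) : Prop where
  zero : s 0 = 0
  mono : ∀ a b, a ≤ b → b ≤ n → s a ≤ s b
  last_le : s n ≤ n
  one_le : 1 ≤ i
  lt : i < j
  le : j ≤ n
  left : s (i - 1) < s i
  const : ∀ l, i ≤ l → l ≤ j → s l = s i
  right : j < n → s i < s (j + 1)

theorem Cb_eq_zero {x y : ℤ} (h : y < 0 ∨ x < y) : Cb x y = 0 := by
  rw [Cb, if_neg]
  omega

theorem Cb_self {x : ℤ} (h : 0 ≤ x) : Cb x x = 1 := by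
  simp [Cb, h]

theorem Cb_zero_right {x : ℤ} (h : 0 ≤ x) : Cb x 0 = 1 := by
  simp [Cb, h]

theorem Cb_natCast (x y : ℕ) : Cb x y = (x.choose y : ℤ) := by
  rw [Cb]
  split_ifs with h
  · simp
  · rw [Nat.choose_eq_zero_of_lt (by omega)]
    simp

theorem Cb_pascal {x : ℤ} (hx : 0 < x) (y : ℤ) : Cb x y = Cb (x - 1) (y - 1) + Cb (x - 1) y := by
  rcases lt_trichotomy y 0 with hy | rfl | hy
  · rw [Cb_eq_zero (by omega), Cb_eq_zero (by omega), Cb_eq_zero (by omega)]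
    simp
  · rw [Cb_zero_right hx.le, Cb_zero_right (by omega), Cb_eq_zero (by omega)]
    simp
  · obtain ⟨a, rfl⟩ : ∃ a : ℕ, x = a + 1 := ⟨(x - 1).toNat, by omega⟩
    obtain ⟨b, rfl⟩ : ∃ b : ℕ, y = b + 1 := ⟨(y - 1).toNat, by omega⟩
    rw [add_sub_cancel_right, add_sub_cancel_right]
    norm_cast
    rw [Cb_natCast, Cb_natCast, Cb_natCast, Nat.choose_succ_succ]
    simp

theorem Cb_symm {x y : ℤ} : Cb x y = Cb x (x - y) := by
  by_cases h : 0 ≤ y ∧ y ≤ x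
  · obtain ⟨a, rfl⟩ : ∃ a : ℕ, y = a := ⟨y.toNat, by omega⟩
    obtain ⟨b, rfl⟩ : ∃ b : ℕ, x = a + b := ⟨(x - a).toNat, by omega⟩
    rw [add_sub_cancel_left]
    norm_cast
    rw [Cb_natCast, Cb_natCast, Nat.choose_symm_add]
  · rw [Cb_eq_zero (by omega), Cb_eq_zero (by omega)]

section Recursion

variable {n : ℕ} {s : ℕ → ℕ} {i j : ℕ}

theorem sizeFactor_congr {s' : ℕ → ℕ} {k : ℕ} (h1 : s' (k - 1) = s (k - 1)) (h2 : s' k = s k)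
    (h3 : laterCount n s' k = laterCount n s k) : sizeFactor n s' k = sizeFactor n s k := by
  rw [sizeFactor, sizeFactor, h1, h2, h3]

theorem laterCount_update_of_ne {k l x : ℕ} (hk : k ≠ l) (h1 : k < l → s l ≠ s k)
    (h2 : k < l → x ≠ s k) : laterCount n (Function.update s l x) k = laterCount n s k := by
  rw [laterCount, laterCount, Function.update_of_ne hk]
  congr 1
  refine Finset.filter_congr fun m hm => ?_
  rw [Finset.mem_Ioc] at hm
  by_cases hml : m = l
  · subst hml
    rw [Function.update_self]
    simp [h1 hm.1, h2 hm.1]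
  · rw [Function.update_of_ne hml]

theorem laterCount_eq_of_iff {k m : ℕ} (hm : m ≤ n)
    (h : ∀ l, k < l → l ≤ n → (s l = s k ↔ l ≤ m)) : laterCount n s k = m - k := by
  rw [laterCount, ← Nat.card_Ioc k m]
  congr 1
  ext l
  simp only [Finset.mem_filter, Finset.mem_Ioc]
  constructor
  · rintro ⟨⟨h1, h2⟩, h3⟩
    exact ⟨h1, (h l h1 h2).1 h3⟩
  · rintro ⟨h1, h2⟩
    exact ⟨⟨h1, by omega⟩, (h l h1 (by omega)).2 h2⟩

namespace IsBlock

theorem apply_eq_iff (B : IsBlock n s i j) {l : ℕ} (h1 : i ≤ l) (h2 : l ≤ n) :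
    s l = s i ↔ l ≤ j := by
  refine ⟨fun h => ?_, fun h => B.const l h1 h⟩
  by_contra! hlt
  have h3 := B.right (by omega)
  have h4 := B.mono (j + 1) l hlt h2
  omega

theorem lt_of_lt (B : IsBlock n s i j) {k : ℕ} (h : k < i) : s k < s i :=
  (B.mono k (i - 1) (by omega) (by have := B.lt; have := B.le; omega)).trans_lt B.left

theorem apply_le (B : IsBlock n s i j) : s i ≤ n :=
  (B.mono i n (by have := B.lt; have := B.le; omega) le_rfl).trans B.last_le

theorem sizeFactor_self (B : IsBlock n s i j) :
    sizeFactor n s i = Cb ((j : ℤ) - i) ((s i : ℤ) - i) *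
      Cb ((s i : ℤ) - s (i - 1) - 1) ((s i : ℤ) - i) := by
  rw [sizeFactor, if_neg B.left.ne, laterCount_eq_of_iff B.le
    fun l h1 h2 => B.apply_eq_iff h1.le h2]
  have := B.lt
  push_cast [this.le]
  rfl

theorem sizeFactor_of_mem (B : IsBlock n s i j) {k : ℕ} (h1 : i < k) (h2 : k ≤ j) :
    sizeFactor n s k = -1 := by
  rw [sizeFactor, if_pos]
  rw [B.const k h1.le h2, B.const (k - 1) (by omega) (by omega)]

theorem prod_sizeFactor (B : IsBlock n s i j) : ∏ k ∈ Finset.Icc 1 n, sizeFactor n s k =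
    sizeFactor n s i * ∏ k ∈ (Finset.Icc 1 n).erase i, sizeFactor n s k := by
  have h1 := B.one_le
  have h2 := B.lt
  have h3 := B.le
  rw [Finset.mul_prod_erase _ _ (by simp; omega)]

theorem prod_sizeFactor_left (B : IsBlock n s i j) (h1 : s (i - 1) < i) (h2 : i < s i) :
    ∏ k ∈ Finset.Icc 1 n, sizeFactor n (Function.update s i i) k =
      - (Cb ((j : ℤ) - i - 1) ((s i : ℤ) - i - 1) *
        ∏ k ∈ (Finset.Icc 1 n).erase i, sizeFactor n s k) := by
  have hi := B.one_le
  have hij := B.lt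
  have hjn := B.le
  have hmem : i ∈ Finset.Icc 1 n := by simp; omega
  have hmem' : i + 1 ∈ (Finset.Icc 1 n).erase i := by simp; omega
  rw [← Finset.mul_prod_erase _ _ hmem, ← Finset.mul_prod_erase _ _ hmem',
    ← Finset.mul_prod_erase _ _ hmem']
  have e1 : sizeFactor n (Function.update s i i) i = 1 := by
    rw [sizeFactor, Function.update_self, Function.update_of_ne (by omega), if_neg (by omega),
      sub_self, Cb_zero_right (by omega), Cb_zero_right (by omega), one_mul]
  have e2 : sizeFactor n (Function.update s i i) (i + 1) =
      Cb ((j : ℤ) - i - 1) ((s i : ℤ) - i - 1) := by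
    have hc := B.const (i + 1) (by omega) (by omega)
    rw [sizeFactor, add_tsub_cancel_right, Function.update_self,
      Function.update_of_ne (a := i + 1) (by omega), if_neg (by omega),
      laterCount_eq_of_iff B.le (m := j), hc]
    · push_cast
      rw [← sub_sub (s i : ℤ), Cb_self (x := (s i : ℤ) - i - 1) (by omega), mul_one]
      congr 1
      omega
    · intro l hl hln
      rw [Function.update_of_ne (by omega), Function.update_of_ne (by omega), hc]
      exact B.apply_eq_iff (by omega) hln
  rw [e1, e2, B.sizeFactor_of_mem (k := i + 1) (by omega) (by omega)]
  rw [Finset.prod_congr rfl fun k hk => ?_]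
  · ring
  · simp only [Finset.mem_erase, Finset.mem_Icc] at hk
    refine sizeFactor_congr (Function.update_of_ne (by omega) _ _)
      (Function.update_of_ne (by omega) _ _)
      (laterCount_update_of_ne (by omega) (fun h => ?_) (fun h => ?_))
    · exact (B.lt_of_lt h).ne'
    · have := B.mono k (i - 1) (by omega) (by omega)
      omega

theorem prod_sizeFactor_right (B : IsBlock n s i j) (h1 : s i < j) (h2 : j < n → j < s (j + 1)) :
    (if j < n then Cb ((s (j + 1) : ℤ) - s i - 1) ((j : ℤ) - s i) else 1) *
      ∏ k ∈ Finset.Icc 1 n, sizeFactor n (Function.update s j j) k =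
      - (Cb ((j : ℤ) - i - 1) ((s i : ℤ) - i) * Cb ((s i : ℤ) - s (i - 1) - 1) ((s i : ℤ) - i) *
        ∏ k ∈ (Finset.Icc 1 n).erase i, sizeFactor n s k) := by
  have hi := B.one_le
  have hij := B.lt
  have hjn := B.le
  have hmem : i ∈ Finset.Icc 1 n := by simp; omega
  have hmem' : j ∈ (Finset.Icc 1 n).erase i := by simp; omega
  have hcj := B.const j hij.le le_rfl
  rw [← Finset.mul_prod_erase _ _ hmem, ← Finset.mul_prod_erase _ _ hmem',
    ← Finset.mul_prod_erase _ _ hmem']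
  have e1 : sizeFactor n (Function.update s j j) i =
      Cb ((j : ℤ) - i - 1) ((s i : ℤ) - i) * Cb ((s i : ℤ) - s (i - 1) - 1) ((s i : ℤ) - i) := by
    have := B.left
    rw [sizeFactor, Function.update_of_ne (by omega), Function.update_of_ne (by omega),
      if_neg (by omega), laterCount_eq_of_iff (m := j - 1) (by omega)]
    · push_cast [show i ≤ j - 1 by omega, show 1 ≤ j by omega]
      congr 2
      ring
    · intro l hl hln
      rw [Function.update_of_ne (a := i) (by omega)]
      by_cases hlj : l = j
      · subst hlj
        rw [Function.update_self]
        omega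
      · rw [Function.update_of_ne hlj, B.apply_eq_iff hl.le hln]
        omega
  have e2 : sizeFactor n (Function.update s j j) j = 1 := by
    have := B.const (j - 1) (by omega) (by omega)
    rw [sizeFactor, Function.update_self, Function.update_of_ne (by omega), if_neg (by omega),
      sub_self, Cb_zero_right (by omega), Cb_zero_right (by omega), one_mul]
  have e3 : ∀ k ∈ (Finset.Icc 1 n).erase i, k ≠ j → k ≠ j + 1 →
      sizeFactor n (Function.update s j j) k = sizeFactor n s k := by
    intro k hk hkj hkj'
    simp only [Finset.mem_erase, Finset.mem_Icc] at hk
    by_cases hik : i < k ∧ k < j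
    · rw [B.sizeFactor_of_mem hik.1 hik.2.le, sizeFactor, Function.update_of_ne (by omega),
        Function.update_of_ne (by omega), if_pos]
      rw [B.const k hik.1.le hik.2.le, B.const (k - 1) (by omega) (by omega)]
    · refine sizeFactor_congr (Function.update_of_ne (by omega) _ _)
        (Function.update_of_ne (by omega) _ _)
        (laterCount_update_of_ne (by omega) (fun h => ?_) (fun h => ?_))
      · have := B.lt_of_lt (k := k) (by omega)
        omega
      · have := B.lt_of_lt (k := k) (by omega)
        omega
  rw [e1, e2, B.sizeFactor_of_mem (k := j) (by omega) (by omega)]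
  by_cases hjn' : j < n
  · have hmem'' : j + 1 ∈ ((Finset.Icc 1 n).erase i).erase j := by simp; omega
    rw [← Finset.mul_prod_erase _ _ hmem'', ← Finset.mul_prod_erase _ _ hmem'', if_pos hjn']
    have hv := h2 hjn'
    have e4 : Cb ((s (j + 1) : ℤ) - s i - 1) ((j : ℤ) - s i) *
        sizeFactor n (Function.update s j j) (j + 1) = sizeFactor n s (j + 1) := by
      have hl : laterCount n (Function.update s j j) (j + 1) = laterCount n s (j + 1) :=
        laterCount_update_of_ne (by omega) (fun h => by omega) (fun h => by omega)
      rw [sizeFactor, sizeFactor, hl, add_tsub_cancel_right, Function.update_self,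
        Function.update_of_ne (a := j + 1) (by omega), if_neg (by omega), if_neg (by omega), hcj]
      push_cast
      rw [← sub_sub (s (j + 1) : ℤ) j 1, Cb_self (x := (s (j + 1) : ℤ) - j - 1) (by omega),
        Cb_symm (x := (s (j + 1) : ℤ) - s i - 1) (y := (s (j + 1) : ℤ) - j - 1)]
      rw [mul_one, mul_comm]
      congr 2
      ring
    rw [← e4, Finset.prod_congr rfl fun k hk => ?_]
    · ring
    · simp only [Finset.mem_erase] at hk
      exact e3 k (by simp only [Finset.mem_erase]; tauto) (by tauto) (by tauto)
  · rw [if_neg hjn', Finset.prod_congr rfl fun k hk => ?_]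
    · ring
    · simp only [Finset.mem_erase, Finset.mem_Icc] at hk
      exact e3 k (by simp only [Finset.mem_erase, Finset.mem_Icc]; tauto) (by tauto) (by omega)

theorem twoExp_left (B : IsBlock n s i j) (h : i < s i) :
    twoExp n s = twoExp n (Function.update s i i) + if s i = n then 1 else 0 := by
  have hi := B.one_le
  have hij := B.lt
  have hjn := B.le
  have hle := B.apply_le
  rw [twoExp, twoExp, Function.update_of_ne (by omega)]
  have hmem : i ∈ Finset.Icc 1 n := by simp; omega
  have e : ((Finset.Icc 1 n).filter fun k => Function.update s i i k = n) =
      ((Finset.Icc 1 n).filter fun k => s k = n).erase i := by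
    ext k
    by_cases hk : k = i
    · subst hk
      simp
      omega
    · simp [hk]
  rw [e, Finset.card_erase_eq_ite]
  simp only [Finset.mem_filter, hmem, true_and]
  split_ifs with hn
  · have h2 : ({i, j} : Finset ℕ) ⊆ (Finset.Icc 1 n).filter fun k => s k = n := by
      have := B.const j hij.le le_rfl
      intro k hk
      simp only [Finset.mem_insert, Finset.mem_singleton] at hk
      rcases hk with rfl | rfl <;> simp <;> omega
    have h3 := Finset.card_le_card h2
    rw [Finset.card_pair hij.ne] at h3
    omega
  · rfl

theorem twoExp_right (B : IsBlock n s i j) (h : s i < j) (h' : j < n → j < s (j + 1)) :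
    twoExp n s = twoExp n (Function.update s j j) + if j < n then 0 else n - s i - 1 := by
  have hi := B.one_le
  have hij := B.lt
  have hjn := B.le
  have hcj := B.const j hij.le le_rfl
  split_ifs with hn
  · rw [twoExp, twoExp, Function.update_of_ne (by omega), add_zero]
    congr 3
    refine Finset.filter_congr fun k hk => ?_
    by_cases hk : k = j
    · subst hk
      simp
      omega
    · simp [hk]
  · obtain rfl : j = n := by omega
    have e1 : ((Finset.Icc 1 j).filter fun k => s k = j) = ∅ := by
      rw [Finset.filter_eq_empty_iff]
      intro k hk
      have := B.mono k j (Finset.mem_Icc.1 hk).2 le_rfl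
      omega
    have e2 : ((Finset.Icc 1 j).filter fun k => Function.update s j j k = j) = {j} := by
      ext k
      by_cases hk : k = j
      · subst hk
        simp
        omega
      · simp only [Finset.mem_filter, Finset.mem_Icc, Finset.mem_singleton, hk, iff_false,
          Function.update_of_ne hk]
        rintro ⟨h1, h2⟩
        have := B.mono k j h1.2 le_rfl
        omega
    rw [twoExp, twoExp, Function.update_self, e1, e2]
    simp [hcj]

end IsBlock

/-- The number of sets of size `i` that can replace the first set of a block. -/
def leftCount (s : ℕ → ℕ) (i : ℕ) : ℕ :=
  if s (i - 1) < i ∧ i < s i then (s i - (s (i - 1) + 1)).choose (i - (s (i - 1) + 1)) else 0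

/-- The number of sets of size `j` that can replace the last set of a block. -/
def rightCount (n : ℕ) (s : ℕ → ℕ) (j : ℕ) : ℕ :=
  if s j < j then
    if j < n then if j < s (j + 1) then (s (j + 1) - 1 - s j).choose (j - s j) else 0
    else 2 ^ (n - (s j + 1))
  else 0

theorem IsBlock.sizeNumber_eq (B : IsBlock n s i j) :
    sizeNumber n s = -(leftCount s i * (if s i = n then 2 else 1) *
        sizeNumber n (Function.update s i i) +
      rightCount n s j * sizeNumber n (Function.update s j j)) := by
  have hi := B.one_le
  have hij := B.lt
  have hjn := B.le
  have hle := B.apply_le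
  have hcj := B.const j hij.le le_rfl
  have hu := B.left
  set R := ∏ k ∈ (Finset.Icc 1 n).erase i, sizeFactor n s k with hR
  have hL : (leftCount s i : ℤ) * (if s i = n then 2 else 1) *
      sizeNumber n (Function.update s i i) = - (2 ^ twoExp n s *
        (Cb ((s i : ℤ) - s (i - 1) - 1) ((s i : ℤ) - i) *
          Cb ((j : ℤ) - i - 1) ((s i : ℤ) - i - 1) * R)) := by
    rw [leftCount]
    split_ifs with h1 h2 h2
    · rw [sizeNumber, B.prod_sizeFactor_left h1.1 h1.2, B.twoExp_left h1.2, if_pos h2,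
        Cb_symm (y := (s i : ℤ) - i), ← Cb_natCast, ← hR, pow_succ]
      push_cast [show s (i - 1) + 1 ≤ s i by omega, show s (i - 1) + 1 ≤ i by omega]
      ring_nf
    · rw [sizeNumber, B.prod_sizeFactor_left h1.1 h1.2, B.twoExp_left h1.2, if_neg h2,
        Cb_symm (y := (s i : ℤ) - i), ← Cb_natCast, ← hR, add_zero]
      push_cast [show s (i - 1) + 1 ≤ s i by omega, show s (i - 1) + 1 ≤ i by omega]
      ring_nf
    all_goals
      by_cases h3 : s (i - 1) < i
      · rw [Cb_eq_zero (y := (s i : ℤ) - i - 1) (by omega)]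
        simp
      · rw [Cb_eq_zero (y := (s i : ℤ) - i) (by omega)]
        simp
  have hRt : (rightCount n s j : ℤ) * sizeNumber n (Function.update s j j) =
      - (2 ^ twoExp n s * (Cb ((j : ℤ) - i - 1) ((s i : ℤ) - i) *
        Cb ((s i : ℤ) - s (i - 1) - 1) ((s i : ℤ) - i) * R)) := by
    rw [rightCount, hcj]
    split_ifs with h1 h2 h3
    · have := B.prod_sizeFactor_right h1 fun _ => h3
      rw [if_pos h2, ← hR] at this
      rw [sizeNumber, B.twoExp_right h1 fun _ => h3, if_pos h2, add_zero, mul_left_comm,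
        ← mul_neg, ← this, ← Cb_natCast]
      push_cast [show s i ≤ s (j + 1) - 1 by omega, show 1 ≤ s (j + 1) by omega,
        show s i ≤ j by omega]
      rw [sub_right_comm]
    · have h4 : sizeFactor n s (j + 1) = 0 := by
        have := B.right h2
        rw [sizeFactor, add_tsub_cancel_right, if_neg (by omega),
          Cb_eq_zero (y := (s (j + 1) : ℤ) - (j + 1 : ℕ)) (by push_cast; omega), zero_mul]
      have h5 : R = 0 := Finset.prod_eq_zero (i := j + 1) (by simp; omega) h4
      simp [h5]
    · have := B.prod_sizeFactor_right h1 fun h => absurd h h2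
      rw [if_neg h2, one_mul, ← hR] at this
      rw [sizeNumber, this, B.twoExp_right h1 fun h => absurd h h2, if_neg h2, pow_add]
      push_cast
      rw [Nat.sub_sub]
      ring
    · rw [Cb_eq_zero (x := (j : ℤ) - i - 1) (by omega)]
      simp
  rw [hL, hRt, sizeNumber, B.prod_sizeFactor, B.sizeFactor_self, Cb_pascal (by omega), ← hR]
  ring

theorem sizeNumber_eq_zero {k : ℕ} (hk : k ∈ Finset.Icc 1 n) (h1 : s (k - 1) ≠ s k)
    (h2 : ∀ l, k < l → l ≤ n → s l ≠ s k) (h3 : s k ≠ k) : sizeNumber n s = 0 := by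
  have h4 : laterCount n s k = 0 := by
    rw [laterCount, Finset.card_eq_zero, Finset.filter_eq_empty_iff]
    intro l hl
    rw [Finset.mem_Ioc] at hl
    exact h2 l hl.1 hl.2
  rw [sizeNumber, Finset.prod_eq_zero hk, mul_zero]
  rw [sizeFactor, if_neg h1, h4, Cb_eq_zero (by omega), zero_mul]

theorem sizeNumber_of_forall_eq (hn : 1 ≤ n) (h : ∀ k ≤ n, s k = k) : sizeNumber n s = 1 := by
  have h1 : ((Finset.Icc 1 n).filter fun k => s k = n) = {n} := by
    ext k
    simp only [Finset.mem_filter, Finset.mem_Icc, Finset.mem_singleton]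
    constructor
    · rintro ⟨h1, h2⟩
      rwa [h k h1.2] at h2
    · rintro rfl
      exact ⟨⟨hn, le_rfl⟩, h _ le_rfl⟩
  rw [sizeNumber, twoExp, h1, h n le_rfl, Finset.prod_eq_one]
  · simp
  · intro k hk
    rw [Finset.mem_Icc] at hk
    rw [sizeFactor, h k hk.2, h (k - 1) (by omega), if_neg (by omega), sub_self,
      Cb_zero_right (by omega), Cb_zero_right (by omega), one_mul]

end Recursion

theorem card_filter_between {n : ℕ} {A B : Finset (PM n)} (hB : Adm n B) (hAB : A ⊆ B) {c : ℕ}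
    (hc : A.card ≤ c) (hc0 : 0 < c) :
    (Finset.univ.filter fun X : IdxC n => A ⊆ X.1 ∧ X.1 ⊆ B ∧ X.1.card = c).card =
      (B.card - A.card).choose (c - A.card) := by
  rw [← Finset.card_sdiff_of_subset hAB, ← Finset.card_powersetCard]
  refine Finset.card_bij (fun X _ => X.1 \ A) ?_ ?_ ?_
  · intro X hX
    rw [Finset.mem_filter] at hX
    obtain ⟨-, h1, h2, h3⟩ := hX
    rw [Finset.mem_powersetCard, Finset.card_sdiff_of_subset h1, h3]
    exact ⟨Finset.sdiff_subset_sdiff h2 le_rfl, rfl⟩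
  · intro X hX Y hY h
    rw [Finset.mem_filter] at hX hY
    apply Subtype.ext
    rw [← Finset.sdiff_union_of_subset hX.2.1, ← Finset.sdiff_union_of_subset hY.2.1, h]
  · intro Y hY
    rw [Finset.mem_powersetCard] at hY
    have hdis : Disjoint A Y := Finset.disjoint_of_subset_right hY.1 Finset.disjoint_sdiff
    have hcard : (A ∪ Y).card = c := by
      rw [Finset.card_union_of_disjoint hdis, hY.2]
      omega
    have hsub : A ∪ Y ⊆ B := Finset.union_subset hAB (hY.1.trans Finset.sdiff_subset)
    refine ⟨⟨A ∪ Y, hB.subset hsub (Finset.card_pos.1 (by omega))⟩, ?_, ?_⟩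
    · simp [hsub, hcard]
    · simp [Finset.union_sdiff_cancel_left hdis]

theorem card_filter_full {n : ℕ} {A : Finset (PM n)} (hA : Adm n A) :
    (Finset.univ.filter fun X : IdxC n => A ⊆ X.1 ∧ X.1.card = n).card = 2 ^ (n - A.card) := by
  induction hd : n - A.card generalizing A with
  | zero =>
    have hc := hA.card_le
    rw [pow_zero, Finset.card_eq_one]
    refine ⟨⟨A, hA⟩, ?_⟩
    ext X
    simp only [Finset.mem_filter, Finset.mem_univ, true_and, Finset.mem_singleton]
    constructor
    · rintro ⟨h1, h2⟩
      exact Subtype.ext (Finset.eq_of_subset_of_card_le h1 (by omega)).symm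
    · rintro rfl
      exact ⟨le_rfl, by simp only; omega⟩
  | succ d ih =>
    obtain ⟨q, h1, h2⟩ := hA.exists_of_card_lt (by omega)
    have hcq : (insert q A).card = A.card + 1 := Finset.card_insert_of_notMem h1
    have hcq' : (insert (negPM q) A).card = A.card + 1 := Finset.card_insert_of_notMem h2
    rw [pow_succ, mul_two]
    nth_rw 1 [← ih (hA.insert h2) (by omega)]
    rw [← ih (hA.insert (p := negPM q) (by simpa using h1)) (by omega),
      ← Finset.card_union_of_disjoint]
    · congr 1
      ext X
      simp only [Finset.mem_filter, Finset.mem_univ, true_and, Finset.mem_union,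
        Finset.insert_subset_iff]
      constructor
      · rintro ⟨h3, h4⟩
        rcases X.2.mem_or_of_card_eq h4 q with h | h
        · exact Or.inl ⟨⟨h, h3⟩, h4⟩
        · exact Or.inr ⟨⟨h, h3⟩, h4⟩
      · rintro (⟨⟨-, h3⟩, h4⟩ | ⟨⟨-, h3⟩, h4⟩) <;> exact ⟨h3, h4⟩
    · rw [Finset.disjoint_left]
      intro X hX hX'
      simp only [Finset.mem_filter, Finset.mem_univ, true_and,
        Finset.insert_subset_iff] at hX hX'
      exact X.2.2 q hX.1.1 hX'.1.1

/-- A chain `∅ = S_0 ⊆ S_1 ⊆ ⋯ ⊆ S_n` with `S_1, …, S_n` admissible. -/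
structure IsAdmChain (n : ℕ) (S : ℕ → Finset (PM n)) : Prop where
  zero : S 0 = ∅
  adm : ∀ k ∈ Finset.Icc 1 n, Adm n (S k)
  mono : ∀ a b, a ≤ b → b ≤ n → S a ⊆ S b

theorem exists_isBlock {n : ℕ} {s : ℕ → ℕ} (h0 : s 0 = 0) (hmono : ∀ a b, a ≤ b → b ≤ n → s a ≤ s b)
    (hle : s n ≤ n) (hpos : ∀ k, 1 ≤ k → k ≤ n → 0 < s k) {k : ℕ} (hk1 : 1 ≤ k) (hkn : k ≤ n)
    (hk : s (k - 1) = s k) : ∃ i j, IsBlock n s i j := by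
  have hex : ∃ i, s i = s k := ⟨k, rfl⟩
  have hi := Nat.find_spec hex
  have hik : Nat.find hex ≤ k - 1 := Nat.find_min' hex hk
  have hmin : ∀ l, l < Nat.find hex → s l ≠ s k := fun l h => Nat.find_min hex h
  have hj : s (Nat.findGreatest (fun l => s l = s k) n) = s k :=
    Nat.findGreatest_spec (P := fun l => s l = s k) hkn rfl
  have hkj : k ≤ Nat.findGreatest (fun l => s l = s k) n := Nat.le_findGreatest hkn rfl
  have hjn : Nat.findGreatest (fun l => s l = s k) n ≤ n := Nat.findGreatest_le n
  have hmax : ∀ l, Nat.findGreatest (fun l => s l = s k) n < l → l ≤ n → s l ≠ s k :=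
    fun l h1 h2 => Nat.findGreatest_is_greatest (P := fun l => s l = s k) h1 h2
  generalize Nat.find hex = i at *
  generalize Nat.findGreatest (fun l => s l = s k) n = j at *
  have hpk := hpos k hk1 hkn
  have hi1 : 1 ≤ i := by
    by_contra h
    obtain rfl : i = 0 := by omega
    omega
  refine ⟨i, j, h0, hmono, hle, hi1, by omega, hjn, ?_, ?_, ?_⟩
  · have h1 := hmono (i - 1) i (by omega) (by omega)
    have h2 := hmin (i - 1) (by omega)
    omega
  · intro l hil hlj
    have h1 := hmono i l hil (by omega)
    have h2 := hmono l j hlj hjn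
    omega
  · intro hlt
    have h1 := hmono j (j + 1) (by omega) (by omega)
    have h2 := hmax (j + 1) (by omega) (by omega)
    omega

namespace IsAdmChain

variable {n : ℕ} {S : ℕ → Finset (PM n)}

theorem update (hS : IsAdmChain n S) {i : ℕ} (hi : 1 ≤ i) {X : Finset (PM n)} (hX : Adm n X)
    (h1 : S (i - 1) ⊆ X) (h2 : ∀ k, i < k → k ≤ n → X ⊆ S k) :
    IsAdmChain n (Function.update S i X) where
  zero := by rw [Function.update_of_ne (by omega), hS.zero]
  adm k hk := by
    by_cases hki : k = i
    · subst hki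
      rwa [Function.update_self]
    · rw [Function.update_of_ne hki]
      exact hS.adm k hk
  mono a b hab hb := by
    by_cases hai : a = i <;> by_cases hbi : b = i
    · rw [hai, hbi]
    · subst hai
      rw [Function.update_self, Function.update_of_ne hbi]
      exact h2 b (by omega) hb
    · subst hbi
      rw [Function.update_self, Function.update_of_ne hai]
      exact (hS.mono a (b - 1) (by omega) (by omega)).trans h1
    · rw [Function.update_of_ne hai, Function.update_of_ne hbi]
      exact hS.mono a b hab hb

theorem card_update (S : ℕ → Finset (PM n)) (i : ℕ) (X : Finset (PM n)) :
    (fun k => (Function.update S i X k).card) =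
      Function.update (fun k => (S k).card) i X.card := by
  funext k
  by_cases hk : k = i
  · subst hk
    simp
  · simp [hk]

/-- The number of repetitions in a chain. -/
def repeats (n : ℕ) (S : ℕ → Finset (PM n)) : ℕ :=
  ((Finset.Icc 1 n).filter fun k => S (k - 1) = S k).card

theorem repeats_update_lt {i : ℕ} (hi : i ∈ Finset.Icc 1 n) {X : Finset (PM n)}
    (h1 : S (i - 1) ≠ X) (h2 : i < n → X ≠ S (i + 1))
    (h3 : S (i - 1) = S i ∨ i < n ∧ S i = S (i + 1)) :
    repeats n (Function.update S i X) < repeats n S := by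
  rw [Finset.mem_Icc] at hi
  apply Finset.card_lt_card
  have key : ∀ k ∈ Finset.Icc 1 n, Function.update S i X (k - 1) = Function.update S i X k →
      k ≠ i ∧ k ≠ i + 1 ∧ S (k - 1) = S k := by
    intro k hk h
    rw [Finset.mem_Icc] at hk
    by_cases hki : k = i
    · subst hki
      rw [Function.update_self, Function.update_of_ne (by omega)] at h
      exact absurd h h1
    · by_cases hki' : k = i + 1
      · subst hki'
        rw [add_tsub_cancel_right, Function.update_self, Function.update_of_ne (by omega)] at h
        exact absurd h (h2 (by omega))
      · rw [Function.update_of_ne (by omega), Function.update_of_ne hki] at h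
        exact ⟨hki, hki', h⟩
  rw [Finset.ssubset_iff_of_subset]
  · rcases h3 with h3 | ⟨h3, h4⟩
    · refine ⟨i, by simp [hi, h3], fun h => ?_⟩
      rw [Finset.mem_filter] at h
      exact (key i h.1 h.2).1 rfl
    · refine ⟨i + 1, by simp [h4]; omega, fun h => ?_⟩
      rw [Finset.mem_filter] at h
      exact (key (i + 1) h.1 h.2).2.1 rfl
  · intro k hk
    rw [Finset.mem_filter] at hk ⊢
    exact ⟨hk.1, (key k hk.1 hk.2).2.2⟩

theorem card_mono (hS : IsAdmChain n S) {a b : ℕ} (hab : a ≤ b) (hb : b ≤ n) :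
    (S a).card ≤ (S b).card :=
  Finset.card_le_card (hS.mono a b hab hb)

theorem card_eq_of_repeats_eq_zero (hS : IsAdmChain n S) (h : repeats n S = 0) :
    ∀ k ≤ n, (S k).card = k := by
  rw [repeats, Finset.card_eq_zero, Finset.filter_eq_empty_iff] at h
  have hlt : ∀ k < n, (S k).card + 1 ≤ (S (k + 1)).card := by
    intro k hk
    have h1 : S k ⊂ S (k + 1) := by
      refine (hS.mono k (k + 1) (by omega) (by omega)).ssubset_of_ne fun he => ?_
      exact h (x := k + 1) (by simp; omega) (by simpa using he)
    exact Finset.card_lt_card h1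
  have hlow : ∀ k ≤ n, k ≤ (S k).card := by
    intro k
    induction k with
    | zero => simp
    | succ k ih =>
      intro hk
      have := hlt k hk
      have := ih (by omega)
      omega
  have hup : ∀ d ≤ n, (S (n - d)).card + d ≤ n := by
    intro d
    induction d with
    | zero =>
      intro _
      rcases Nat.eq_zero_or_pos n with rfl | hn
      · simp [hS.zero]
      · exact (hS.adm n (by simp; omega)).card_le
    | succ d ih =>
      intro hd
      have h1 := hlt (n - (d + 1)) (by omega)
      have h2 := ih (by omega)
      rw [show n - (d + 1) + 1 = n - d by omega] at h1
      omega
  intro k hk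
  have h1 := hlow k hk
  have h2 := hup (n - k) (by omega)
  rw [show n - (n - k) = k by omega] at h2
  omega

theorem apply_eq_of_isBlock (hS : IsAdmChain n S) {i j : ℕ}
    (B : IsBlock n (fun k => (S k).card) i j) {l : ℕ} (h1 : i ≤ l) (h2 : l ≤ j) : S l = S i :=
  (Finset.eq_of_subset_of_card_le (hS.mono i l h1 (h2.trans B.le)) (B.const l h1 h2).le).symm

theorem prod_erase_eq_of_apply_eq {i j : ℕ} (hi : i ∈ Finset.Icc 1 n) (hj : j ∈ Finset.Icc 1 n)
    (hij : i ≠ j) (h : S j = S i) : ∏ k ∈ (Finset.Icc 1 n).erase i, tauC n (S k) =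
      ∏ k ∈ (Finset.Icc 1 n).erase j, tauC n (S k) := by
  rw [← Finset.mul_prod_erase _ _ (Finset.mem_erase.2 ⟨hij.symm, hj⟩),
    ← Finset.mul_prod_erase _ _ (Finset.mem_erase.2 ⟨hij, hi⟩), h, Finset.erase_right_comm]

/-- The admissible sets of size `i` that can replace the first set of a block. -/
def leftSets (S : ℕ → Finset (PM n)) (i : ℕ) (p : PM n) : Finset (IdxC n) :=
  Finset.univ.filter fun X => insert p (S (i - 1)) ⊆ X.1 ∧ X.1 ⊂ S i ∧ X.1.card = i

/-- The admissible sets of size `j` that can replace the last set of a block. -/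
def rightSets (S : ℕ → Finset (PM n)) (j : ℕ) (q : PM n) : Finset (IdxC n) :=
  Finset.univ.filter fun X => S j ⊂ X.1 ∧ q ∉ X.1 ∧ (j < n → X.1 ⊆ S (j + 1)) ∧ X.1.card = j

theorem card_leftSets (hS : IsAdmChain n S) {i : ℕ} (hi : i ∈ Finset.Icc 1 n) {p : PM n}
    (hp : p ∈ S i) (hp' : p ∉ S (i - 1)) :
    (leftSets S i p).card = leftCount (fun k => (S k).card) i := by
  have hi' := Finset.mem_Icc.1 hi
  have hins : insert p (S (i - 1)) ⊆ S i :=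
    Finset.insert_subset hp (hS.mono _ _ (by omega) hi'.2)
  have hc : (insert p (S (i - 1))).card = (S (i - 1)).card + 1 := Finset.card_insert_of_notMem hp'
  rw [leftCount]
  split_ifs with h
  · rw [← hc, ← card_filter_between (hS.adm i hi) hins (by omega) (by omega), leftSets]
    congr 1
    refine Finset.filter_congr fun X _ => ?_
    refine and_congr_right fun _ => and_congr_left fun h1 => ⟨fun h2 => h2.1, fun h2 => ?_⟩
    refine h2.ssubset_of_ne fun he => ?_
    rw [he] at h1
    omega
  · rw [Finset.card_eq_zero, leftSets, Finset.filter_eq_empty_iff]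
    rintro X - ⟨h1, h2, h3⟩
    have h4 := Finset.card_le_card h1
    have h5 := Finset.card_lt_card h2
    omega

theorem card_rightSets (hS : IsAdmChain n S) {j : ℕ} (hj : j ∈ Finset.Icc 1 n) {q : PM n}
    (hq : (S j).card < n → q ∉ S j ∧ negPM q ∉ S j) (hq' : j < n → q ∈ S (j + 1)) :
    (rightSets S j q).card = rightCount n (fun k => (S k).card) j := by
  have hj' := Finset.mem_Icc.1 hj
  rw [rightCount]
  split_ifs with h1 h2 h3
  · obtain ⟨hqj, hnq⟩ := hq (by omega)
    have hadm := hS.adm (j + 1) (by simp; omega)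
    have hsub : S j ⊆ (S (j + 1)).erase q := by
      intro x hx
      rw [Finset.mem_erase]
      exact ⟨fun h => hqj (h ▸ hx), hS.mono j (j + 1) (by omega) (by omega) hx⟩
    have hc : ((S (j + 1)).erase q).card = (S (j + 1)).card - 1 :=
      Finset.card_erase_of_mem (hq' h2)
    rw [← hc, ← card_filter_between (hadm.subset (Finset.erase_subset _ _)
      ((hS.adm j hj).1.mono hsub)) hsub h1.le (by omega), rightSets]
    congr 1
    refine Finset.filter_congr fun X _ => ?_
    rw [Finset.subset_erase]
    constructor
    · rintro ⟨h4, h5, h6, h7⟩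
      exact ⟨h4.1, ⟨h6 h2, h5⟩, h7⟩
    · rintro ⟨h4, ⟨h5, h6⟩, h7⟩
      refine ⟨h4.ssubset_of_ne fun he => ?_, h6, fun _ => h5, h7⟩
      rw [he] at h1
      omega
  · rw [Finset.card_eq_zero, rightSets, Finset.filter_eq_empty_iff]
    rintro X - ⟨h4, h5, h6, h7⟩
    have h8 : X.1 ⊂ S (j + 1) := (h6 h2).ssubset_of_ne fun he => h5 (he ▸ hq' h2)
    have := Finset.card_lt_card h8
    omega
  · obtain ⟨hqj, hnq⟩ := hq (by omega)
    obtain rfl : j = n := by omega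
    have hc : (insert (negPM q) (S j)).card = (S j).card + 1 := Finset.card_insert_of_notMem hnq
    rw [← hc, ← card_filter_full ((hS.adm j hj).insert (p := negPM q) (by simpa using hqj)),
      rightSets]
    congr 1
    refine Finset.filter_congr fun X _ => ?_
    rw [Finset.insert_subset_iff]
    constructor
    · rintro ⟨h4, h5, h6, h7⟩
      exact ⟨⟨(X.2.mem_or_of_card_eq h7 q).resolve_left h5, h4.1⟩, h7⟩
    · rintro ⟨⟨h4, h5⟩, h6⟩
      refine ⟨h5.ssubset_of_ne fun he => ?_, fun h => X.2.2 q h h4, fun h => absurd h h2, h6⟩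
      exact hnq (he ▸ h4)
  · rw [Finset.card_eq_zero, rightSets, Finset.filter_eq_empty_iff]
    rintro X - ⟨h4, h5, h6, h7⟩
    have := Finset.card_lt_card h4
    omega

theorem prod_update_left (hS : IsAdmChain n S) {i j : ℕ}
    (B : IsBlock n (fun k => (S k).card) i j)
    (ih : ∀ S' : ℕ → Finset (PM n), IsAdmChain n S' → repeats n S' < repeats n S →
      ∏ k ∈ Finset.Icc 1 n, tauC n (S' k) = (sizeNumber n (fun k => (S' k).card) : RC n) * ptC n)
    {X : Finset (PM n)} (h1 : S (i - 1) ⊂ X) (h2 : X ⊂ S i) :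
    ∏ k ∈ Finset.Icc 1 n, tauC n (Function.update S i X k) =
      ((if X.card = i then sizeNumber n (Function.update (fun k => (S k).card) i i) else 0 : ℤ) :
        RC n) * ptC n := by
  have hi := B.one_le
  have hij := B.lt
  have hjn := B.le
  have hmem : i ∈ Finset.Icc 1 n := by simp; omega
  have hne : X.Nonempty := Finset.nonempty_iff_ne_empty.2 fun h => by simp [h] at h1
  have hc1 := Finset.card_lt_card h1
  have hc2 := Finset.card_lt_card h2
  have heq : S (i + 1) = S i := hS.apply_eq_of_isBlock B (by omega) (by omega)
  rw [ih _ (hS.update hi ((hS.adm i hmem).subset h2.1 hne) h1.1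
      fun k hk hkn => h2.1.trans (hS.mono i k hk.le hkn))
    (repeats_update_lt hmem h1.ne (fun _ => heq ▸ h2.ne) (Or.inr ⟨by omega, heq.symm⟩)),
    card_update]
  congr 2
  split_ifs with h
  · rw [h]
  · refine sizeNumber_eq_zero hmem ?_ ?_ ?_
    · rw [Function.update_self, Function.update_of_ne (by omega)]
      exact hc1.ne
    · intro l hl hln
      rw [Function.update_self, Function.update_of_ne (by omega)]
      have := hS.card_mono hl.le hln
      omega
    · rwa [Function.update_self]

theorem prod_update_right (hS : IsAdmChain n S) {i j : ℕ}
    (B : IsBlock n (fun k => (S k).card) i j)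
    (ih : ∀ S' : ℕ → Finset (PM n), IsAdmChain n S' → repeats n S' < repeats n S →
      ∏ k ∈ Finset.Icc 1 n, tauC n (S' k) = (sizeNumber n (fun k => (S' k).card) : RC n) * ptC n)
    {X : Finset (PM n)} (hX : Adm n X) (h1 : S j ⊂ X) (h2 : j < n → X ⊂ S (j + 1)) :
    ∏ k ∈ Finset.Icc 1 n, tauC n (Function.update S j X k) =
      ((if X.card = j then sizeNumber n (Function.update (fun k => (S k).card) j j) else 0 : ℤ) :
        RC n) * ptC n := by
  have hi := B.one_le
  have hij := B.lt
  have hjn := B.le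
  have hmem : j ∈ Finset.Icc 1 n := by simp; omega
  have hc1 := Finset.card_lt_card h1
  have heq : S (j - 1) = S j := by
    rw [hS.apply_eq_of_isBlock B (l := j) (by omega) le_rfl,
      hS.apply_eq_of_isBlock B (l := j - 1) (by omega) (by omega)]
  rw [ih _ (hS.update (by omega) hX (heq ▸ h1.1)
      fun k hk hkn => (h2 (by omega)).1.trans (hS.mono (j + 1) k hk hkn))
    (repeats_update_lt hmem (heq ▸ h1.ne) (fun h => (h2 h).ne) (Or.inl heq)),
    card_update]
  congr 2
  split_ifs with h
  · rw [h]
  · refine sizeNumber_eq_zero hmem ?_ ?_ ?_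
    · rw [Function.update_self, Function.update_of_ne (by omega), heq]
      exact hc1.ne
    · intro l hl hln
      rw [Function.update_self, Function.update_of_ne (by omega)]
      have h3 := Finset.card_lt_card (h2 (by omega))
      have : (S (j + 1)).card ≤ (S l).card := hS.card_mono hl hln
      omega
    · rwa [Function.update_self]

/-- The conditions on a root `t_p - t_q` used to rewrite the square of the class of the set shared
by the indices `i, …, j` of a chain. -/
structure IsRewritingRoot (S : ℕ → Finset (PM n)) (i j : ℕ) (p q : PM n) : Prop where
  mem : p ∈ S i
  notMem : p ∉ S (i - 1)
  full : (S i).card = n → q = negPM p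
  notFull : (S i).card < n → q ∉ S i ∧ negPM q ∉ S i
  mem_right : j < n → q ∈ S (j + 1)

theorem exists_isRewritingRoot (hS : IsAdmChain n S) {i j : ℕ}
    (B : IsBlock n (fun k => (S k).card) i j) : ∃ p q, IsRewritingRoot S i j p q := by
  have hi := B.one_le
  have hij := B.lt
  have hjn := B.le
  have hadm := hS.adm i (by simp; omega)
  obtain ⟨p, hp, hp'⟩ := Finset.exists_mem_notMem_of_card_lt_card B.left
  by_cases hj : j < n
  · have hc := B.right hj
    have hadm' := hS.adm (j + 1) (by simp; omega)
    have hlt : (S i).card < n := hc.trans_le hadm'.card_le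
    obtain ⟨q, hq, hq'⟩ := Finset.exists_mem_notMem_of_card_lt_card hc
    refine ⟨p, q, hp, hp', fun h => by omega, fun _ => ⟨hq', fun h => ?_⟩, fun _ => hq⟩
    exact hadm'.2 q hq (hS.mono i (j + 1) (by omega) (by omega) h)
  · by_cases hlt : (S i).card < n
    · obtain ⟨q, hq, hq'⟩ := hadm.exists_of_card_lt hlt
      exact ⟨p, q, hp, hp', fun h => by omega, fun _ => ⟨hq, hq'⟩, fun h => absurd h hj⟩
    · exact ⟨p, negPM p, hp, hp', fun _ => rfl, fun h => absurd h hlt, fun h => absurd h hj⟩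

namespace IsRewritingRoot

variable {i j : ℕ} {p q : PM n}

theorem rootCoeff_self (R : IsRewritingRoot S i j p q) (hT : Adm n (S i)) :
    rootCoeff p q (S i) = 1 := by
  have hp := R.mem
  have hnp := hT.2 p hp
  by_cases h : (S i).card < n
  · have hq := R.notFull h
    simp [rootCoeff, signedEps, h, hp, hq]
  · have hq := R.full (by have := hT.card_le; omega)
    subst hq
    simp [rootCoeff, signedEps_negPM p hT, h]
    simp [signedEps, hp]

theorem rootCoeff_of_ssubset (R : IsRewritingRoot S i j p q) (hT : Adm n (S i)) {X : Finset (PM n)}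
    (hX : Adm n X) (h : X ⊂ S i) :
    rootCoeff p q X = if p ∈ X then (if (S i).card = n then 2 else 1) else 0 := by
  have hnp : negPM p ∉ X := fun h' => hT.2 p R.mem (h.1 h')
  have hc := Finset.card_lt_card h
  have hc' := hT.card_le
  by_cases hn : (S i).card = n
  · rw [rootCoeff, if_pos (by omega), R.full hn, signedEps_negPM p hX, if_pos hn]
    simp [signedEps, hnp]
    split_ifs <;> norm_num
  · have hq := R.notFull (by omega)
    have h1 : q ∉ X := fun h' => hq.1 (h.1 h')
    have h2 : negPM q ∉ X := fun h' => hq.2 (h.1 h')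
    rw [rootCoeff, if_pos (by omega), if_neg hn]
    simp [signedEps, hnp, h1, h2]

theorem rootCoeff_of_mem (R : IsRewritingRoot S i j p q) {X : Finset (PM n)}
    (h : S i ⊂ X) (hq : q ∈ X) : rootCoeff p q X = 0 := by
  simp [rootCoeff, signedEps, hq, h.1 R.mem]

theorem rootCoeff_of_notMem (R : IsRewritingRoot S i j p q) {X : Finset (PM n)}
    (hX : Adm n X) (h : S i ⊂ X) (hq : q ∉ X) (hc : negPM q ∈ X → X.card = n) :
    rootCoeff p q X = 1 := by
  by_cases hnq : negPM q ∈ X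
  · simp [rootCoeff, signedEps, hq, hnq, h.1 R.mem, hc hnq]
  · have h1 : X.card < n := by
      refine lt_of_le_of_ne hX.card_le fun h2 => ?_
      exact (hX.mem_or_of_card_eq h2 q).elim hq hnq
    simp [rootCoeff, signedEps, hq, hnq, h.1 R.mem, h1]

end IsRewritingRoot

theorem rootCoeff_mul_prod_erase (hS : IsAdmChain n S) {i j : ℕ}
    (B : IsBlock n (fun k => (S k).card) i j) {p q : PM n} (R : IsRewritingRoot S i j p q)
    (ih : ∀ S' : ℕ → Finset (PM n), IsAdmChain n S' → repeats n S' < repeats n S →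
      ∏ k ∈ Finset.Icc 1 n, tauC n (S' k) = (sizeNumber n (fun k => (S' k).card) : RC n) * ptC n)
    (X : IdxC n) (hXT : X.1 ≠ S i) :
    (rootCoeff p q X.1 : RC n) *
        ((∏ k ∈ (Finset.Icc 1 n).erase i, tauC n (S k)) * tauC n X.1) =
      (((if X ∈ leftSets S i p then (if (S i).card = n then 2 else 1) *
          sizeNumber n (Function.update (fun k => (S k).card) i i) else 0) +
        (if X ∈ rightSets S j q then
          sizeNumber n (Function.update (fun k => (S k).card) j j) else 0) : ℤ) : RC n) *
        ptC n := by
  have hi := B.one_le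
  have hij := B.lt
  have hjn := B.le
  have hmi : i ∈ Finset.Icc 1 n := by simp; omega
  have hmj : j ∈ Finset.Icc 1 n := by simp; omega
  have hji : S j = S i := hS.apply_eq_of_isBlock B hij.le le_rfl
  have hT := hS.adm i hmi
  have hQ := prod_erase_eq_of_apply_eq hmi hmj hij.ne hji
  simp only [leftSets, rightSets, Finset.mem_filter, Finset.mem_univ, true_and, hji,
    Finset.insert_subset_iff]
  by_cases h1 : X.1 ⊂ S i
  · have h1' : ¬ S i ⊂ X.1 := fun h => h1.2 h.1
    rw [R.rootCoeff_of_ssubset hT X.2 h1]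
    by_cases hp : p ∈ X.1
    · by_cases hU : S (i - 1) ⊆ X.1
      · have hU' : S (i - 1) ⊂ X.1 := hU.ssubset_of_ne fun h => R.notMem (h ▸ hp)
        rw [← prod_tauC_update S hmi, hS.prod_update_left B ih hU' h1, ← mul_assoc,
          ← Int.cast_mul]
        simp [hp, hU, h1, h1']
      · have hi1 : i ≠ 1 := by
          rintro rfl
          exact hU (by simp [hS.zero])
        rw [prod_erase_mul_tauC_eq_zero (k := i - 1) (by simp; omega) (by omega) X.2
          (hS.adm _ (by simp; omega)) (fun h => R.notMem (h hp)) hU]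
        simp [hU, h1']
    · simp [hp, h1']
  by_cases h2 : S i ⊂ X.1
  · by_cases hq : q ∈ X.1
    · rw [R.rootCoeff_of_mem h2 hq]
      simp [h1, hq]
    · by_cases hV : j < n → X.1 ⊆ S (j + 1)
      · have hV' : j < n → X.1 ⊂ S (j + 1) := fun h =>
          (hV h).ssubset_of_ne fun he => hq (he ▸ R.mem_right h)
        rw [hQ, ← prod_tauC_update S hmj, hS.prod_update_right B ih X.2 (hji ▸ h2) hV',
          ← mul_assoc, ← Int.cast_mul]
        congr 2
        by_cases hc : X.1.card = j
        · rw [R.rootCoeff_of_notMem X.2 h2 hq]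
          · simp only [h1, h2, hq, hc]
            simpa using fun h h' => absurd (hV h) h'
          · intro hnq
            by_cases hlt : j < n
            · exact absurd (hV hlt hnq) ((hS.adm (j + 1) (by simp; omega)).2 q (R.mem_right hlt))
            · omega
        · simp [h1, hc]
      · push Not at hV
        rw [prod_erase_mul_tauC_eq_zero (k := j + 1) (by simp; omega) (by omega) X.2
          (hS.adm _ (by simp; omega)) hV.2 (fun h => hq (h (R.mem_right hV.1)))]
        simp [h1, hV]
  · rw [prod_erase_mul_tauC_eq_zero hmj hij.ne' X.2 (hS.adm _ hmj)
      (fun h => h1 (by rw [hji] at h; exact h.ssubset_of_ne hXT))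
      (fun h => h2 (by rw [hji] at h; exact h.ssubset_of_ne hXT.symm))]
    simp [h1, h2]

theorem prod_eq_of_isBlock (hS : IsAdmChain n S) {i j : ℕ}
    (B : IsBlock n (fun k => (S k).card) i j)
    (ih : ∀ S' : ℕ → Finset (PM n), IsAdmChain n S' → repeats n S' < repeats n S →
      ∏ k ∈ Finset.Icc 1 n, tauC n (S' k) = (sizeNumber n (fun k => (S' k).card) : RC n) * ptC n) :
    ∏ k ∈ Finset.Icc 1 n, tauC n (S k) = (sizeNumber n (fun k => (S k).card) : RC n) * ptC n := by
  have hi := B.one_le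
  have hij := B.lt
  have hjn := B.le
  have hmi : i ∈ Finset.Icc 1 n := by simp; omega
  have hmj : j ∈ Finset.Icc 1 n := by simp; omega
  have hji : S j = S i := hS.apply_eq_of_isBlock B hij.le le_rfl
  have hT := hS.adm i hmi
  obtain ⟨p, q, R⟩ := hS.exists_isRewritingRoot B
  have h0 := congrArg ((∏ k ∈ (Finset.Icc 1 n).erase i, tauC n (S k)) * ·)
    (sum_rootCoeff_mul_tauC p q)
  simp only [Finset.mul_sum, mul_zero] at h0
  have hterm : ∀ X : IdxC n, (∏ k ∈ (Finset.Icc 1 n).erase i, tauC n (S k)) *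
      ((rootCoeff p q X.1 : RC n) * tauC n X.1) =
      (if X = ⟨S i, hT⟩ then ∏ k ∈ Finset.Icc 1 n, tauC n (S k) else 0) +
      (((if X ∈ leftSets S i p then (if (S i).card = n then 2 else 1) *
          sizeNumber n (Function.update (fun k => (S k).card) i i) else 0) +
        (if X ∈ rightSets S j q then
          sizeNumber n (Function.update (fun k => (S k).card) j j) else 0) : ℤ) : RC n) *
        ptC n := by
    intro X
    rw [mul_left_comm]
    by_cases hX : X = ⟨S i, hT⟩
    · subst hX
      rw [if_pos rfl, R.rootCoeff_self hT, Finset.prod_erase_mul _ _ hmi]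
      simp [leftSets, rightSets, hji]
    · rw [if_neg hX, zero_add]
      exact hS.rootCoeff_mul_prod_erase B R ih X fun h => hX (Subtype.ext h)
  rw [Finset.sum_congr rfl fun X _ => hterm X, Finset.sum_add_distrib, ← Finset.sum_mul,
    ← Int.cast_sum, Finset.sum_add_distrib, Finset.sum_ite_mem, Finset.sum_ite_mem,
    Finset.univ_inter, Finset.univ_inter, Finset.sum_const, Finset.sum_const,
    hS.card_leftSets hmi R.mem R.notMem,
    hS.card_rightSets hmj (by rw [hji]; exact R.notFull) R.mem_right] at h0
  rw [B.sizeNumber_eq]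
  simp only [Finset.sum_ite_eq', Finset.mem_univ, if_true, nsmul_eq_mul] at h0
  push_cast at h0 ⊢
  linear_combination h0

theorem prod_tauC_eq (hn : 1 ≤ n) (hS : IsAdmChain n S) :
    ∏ k ∈ Finset.Icc 1 n, tauC n (S k) = (sizeNumber n (fun k => (S k).card) : RC n) * ptC n := by
  induction hm : repeats n S using Nat.strong_induction_on generalizing S with
  | _ m ih =>
    by_cases h0 : repeats n S = 0
    · have hc := hS.card_eq_of_repeats_eq_zero h0
      rw [prod_tauC_eq_ptC S hS.adm hS.mono hc, sizeNumber_of_forall_eq hn hc]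
      simp
    · obtain ⟨k, hk⟩ := Finset.card_pos.1 (Nat.pos_of_ne_zero h0)
      rw [Finset.mem_filter, Finset.mem_Icc] at hk
      obtain ⟨i, j, B⟩ := exists_isBlock (s := fun k => (S k).card) (by simp [hS.zero])
        (fun a b hab hb => hS.card_mono hab hb) (hS.adm n (by simp; omega)).card_le
        (fun k h1 h2 => Finset.card_pos.2 (hS.adm k (by simp; omega)).1) hk.1.1 hk.1.2
        (by simp only [hk.2])
      exact hS.prod_eq_of_isBlock B fun S' hS' hlt => ih _ (hm ▸ hlt) hS' rfl

end IsAdmChain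


section Corners

variable {n : ℕ} {lam : ℕ → ℕ}

theorem mem_cornerL {i : ℕ} :
    i ∈ cornerL n lam ↔ (1 ≤ i ∧ i ≤ n) ∧ lamE n lam (i + 1) < lamE n lam i := by
  simp [cornerL]

theorem iC_eq_getElem {r : ℕ} (h : r < (cornerL n lam).length) :
    iC n lam (r + 1) = (cornerL n lam)[r] := by
  simp [iC, h]

theorem iC_sC_add_one : iC n lam (sC n lam + 1) = n + 1 := by
  simp [iC, sC]

theorem iC_mem {r : ℕ} (h1 : 1 ≤ r) (h2 : r ≤ sC n lam) : iC n lam r ∈ cornerL n lam := by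
  obtain ⟨r, rfl⟩ : ∃ r', r = r' + 1 := ⟨r - 1, by omega⟩
  rw [iC_eq_getElem h2]
  exact List.getElem_mem _

theorem exists_iC_eq {i : ℕ} (hi : i ∈ cornerL n lam) :
    ∃ r, 1 ≤ r ∧ r ≤ sC n lam ∧ iC n lam r = i := by
  obtain ⟨r, hr, h⟩ := List.getElem_of_mem hi
  exact ⟨r + 1, by omega, hr, by rw [iC_eq_getElem hr, h]⟩

theorem iC_lt_iC {r t : ℕ} (h : r < t) (ht : t ≤ sC n lam + 1) : iC n lam r < iC n lam t := by
  rcases ht.eq_or_lt with rfl | ht'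
  · rw [iC_sC_add_one]
    rcases Nat.eq_zero_or_pos r with rfl | hr
    · simp [iC]
    · have := (mem_cornerL.1 (iC_mem (n := n) (lam := lam) hr (by omega))).1.2
      omega
  · have hmt := mem_cornerL.1 (iC_mem (by omega) (Nat.lt_succ_iff.1 ht'))
    rcases Nat.eq_zero_or_pos r with rfl | hr
    · rw [show iC n lam 0 = 0 from rfl]
      exact hmt.1.1
    · obtain ⟨r, rfl⟩ : ∃ r', r = r' + 1 := ⟨r - 1, by omega⟩
      obtain ⟨t, rfl⟩ : ∃ t', t = t' + 1 := ⟨t - 1, by omega⟩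
      rw [iC_eq_getElem (by unfold sC at ht; omega), iC_eq_getElem (by unfold sC at ht'; omega)]
      exact (Finset.sortedLT_sort _).getElem_lt_getElem_iff.2 (by omega)

theorem notMem_cornerL {r l : ℕ} (hr : r ≤ sC n lam) (h1 : iC n lam r < l)
    (h2 : l < iC n lam (r + 1)) : l ∉ cornerL n lam := by
  intro hl
  obtain ⟨t, ht1, ht2, rfl⟩ := exists_iC_eq hl
  rcases lt_trichotomy t r with h | rfl | h
  · have := iC_lt_iC (n := n) (lam := lam) h (by omega)
    omega
  · omega
  · rcases Nat.eq_or_lt_of_le (show r + 1 ≤ t from h) with h | h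
    · subst h
      omega
    · have := iC_lt_iC (n := n) (lam := lam) h (by omega)
      omega

theorem lamE_anti (hlam : ∀ i j, 1 ≤ i → i ≤ j → j ≤ n → lam j ≤ lam i) {i j : ℕ} (hi : 1 ≤ i)
    (hij : i ≤ j) : lamE n lam j ≤ lamE n lam i := by
  by_cases hj : j ≤ n
  · rw [lamE, lamE, if_pos hj, if_pos (hij.trans hj)]
    exact hlam i j hi hij hj
  · rw [lamE, if_neg hj]
    exact Nat.zero_le _

theorem lamE_eq_lamE_iC (hlam : ∀ i j, 1 ≤ i → i ≤ j → j ≤ n → lam j ≤ lam i) {r l : ℕ}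
    (hr : r ≤ sC n lam) (h1 : iC n lam r < l) (h2 : l ≤ iC n lam (r + 1)) :
    lamE n lam l = lamE n lam (iC n lam (r + 1)) := by
  have hle : iC n lam (r + 1) ≤ n + 1 := by
    rw [← iC_sC_add_one (n := n) (lam := lam)]
    rcases hr.eq_or_lt with rfl | h
    · exact le_rfl
    · exact (iC_lt_iC (by omega) le_rfl).le
  obtain ⟨d, hd⟩ : ∃ d, iC n lam (r + 1) = l + d := ⟨_, (Nat.add_sub_cancel' h2).symm⟩
  induction d generalizing l with
  | zero => rw [hd, add_zero]
  | succ d ih =>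
    rw [← ih (l := l + 1) (by omega) (by omega) (by omega)]
    have h3 := notMem_cornerL hr h1 (by omega)
    rw [mem_cornerL] at h3
    have h4 := lamE_anti hlam (i := l) (j := l + 1) (by omega) (by omega)
    omega

end Corners

section Conversion

variable {n : ℕ} {s : ℕ → ℕ}

theorem lamE_reverse (h0 : s 0 = 0) (i : ℕ) :
    lamE n (fun i => s (n + 1 - i)) i = s (n + 1 - i) := by
  rw [lamE]
  split_ifs with h
  · rfl
  · rw [show n + 1 - i = 0 by omega, h0]

theorem yC_reverse (h0 : s 0 = 0) (hs : ∀ a b, a ≤ b → b ≤ n → s a ≤ s b) {r : ℕ} (h1 : 1 ≤ r)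
    (h2 : r ≤ sC n fun i => s (n + 1 - i)) :
    yC n (fun i => s (n + 1 - i)) r = sizeFactor n s (n + 1 - iC n (fun i => s (n + 1 - i)) r) := by
  obtain ⟨r, rfl⟩ : ∃ r', r = r' + 1 := ⟨r - 1, by omega⟩
  have hanti : ∀ i j, 1 ≤ i → i ≤ j → j ≤ n →
      (fun i => s (n + 1 - i)) j ≤ (fun i => s (n + 1 - i)) i :=
    fun i j _ _ _ => hs _ _ (by omega) (by omega)
  have hm := mem_cornerL.1 (iC_mem h1 h2)
  have hlt := iC_lt_iC (Nat.lt_succ_self r) (h2.trans (Nat.le_succ _))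
  have hlt' := iC_lt_iC (Nat.lt_succ_self (r + 1)) (Nat.succ_le_succ h2)
  have hprev := fun l => lamE_eq_lamE_iC hanti (r := r) (l := l) (by omega)
  have hnext := lamE_eq_lamE_iC hanti (r := r + 1) h2 (Nat.lt_succ_self _) hlt'
  have hmr : 1 ≤ r → iC n (fun i => s (n + 1 - i)) r ∈ cornerL n (fun i => s (n + 1 - i)) :=
    fun h => iC_mem h (by omega)
  rw [yC, aC, bC, cC, add_tsub_cancel_right, ← hnext]
  rw [mem_cornerL] at hmr
  simp only [lamE_reverse h0] at hm hprev hmr ⊢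
  set i := iC n (fun i => s (n + 1 - i)) (r + 1) with hi
  set p := iC n (fun i => s (n + 1 - i)) r with hp
  rw [sizeFactor, show n + 1 - i - 1 = n + 1 - (i + 1) by omega, if_neg hm.2.ne,
    laterCount_eq_of_iff (m := n - p) (by omega)]
  · rw [show ((n - p - (n + 1 - i) : ℕ) : ℤ) = (i : ℤ) - p - 1 by omega,
      show (s (n + 1 - i) : ℤ) - (n + 1 - i : ℕ) = s (n + 1 - i) + i - n - 1 by omega]
  · intro l hl hln
    obtain ⟨l', rfl⟩ : ∃ l', l = n + 1 - l' := ⟨n + 1 - l, by omega⟩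
    constructor
    · intro he
      by_contra! hlp
      have hr : 1 ≤ r := by
        by_contra! hr
        obtain rfl : r = 0 := by omega
        rw [show p = 0 from rfl] at hlp
        omega
      have h3 := (hmr hr).2
      have h4 := hprev (p + 1) (by omega) (by omega)
      have h5 := hs (n + 1 - p) (n + 1 - l') (by omega) hln
      omega
    · intro h
      exact hprev l' (by omega) (by omega)

theorem prod_sizeFactor_eq_IY (h0 : s 0 = 0) (hs : ∀ a b, a ≤ b → b ≤ n → s a ≤ s b) :
    ∏ k ∈ Finset.Icc 1 n, sizeFactor n s k = IY n fun i => s (n + 1 - i) := by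
  have hcard : ((Finset.Icc 1 n).filter fun k => ¬ s (k - 1) = s k).card =
      sC n fun i => s (n + 1 - i) := by
    rw [sC, cornerL, Finset.length_sort]
    refine Finset.card_nbij' (fun k => n + 1 - k) (fun k => n + 1 - k) ?_ ?_ ?_ ?_
    · intro k hk
      simp only [Finset.coe_filter, Finset.mem_Icc, Set.mem_ofPred_eq, lamE_reverse h0] at hk ⊢
      have := hs (k - 1) k (by omega) (by omega)
      rw [show n + 1 - (n + 1 - k + 1) = k - 1 by omega, show n + 1 - (n + 1 - k) = k by omega]
      omega
    · intro k hk
      simp only [Finset.coe_filter, Finset.mem_Icc, Set.mem_ofPred_eq, lamE_reverse h0] at hk ⊢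
      rw [show n + 1 - k - 1 = n + 1 - (k + 1) by omega]
      omega
    · intro k hk
      simp only [Finset.coe_filter, Finset.mem_Icc, Set.mem_ofPred_eq] at hk
      dsimp only
      omega
    · intro k hk
      simp only [Finset.coe_filter, Finset.mem_Icc, Set.mem_ofPred_eq] at hk
      dsimp only
      omega
  have hcount := Finset.card_filter_add_card_filter_not (s := Finset.Icc 1 n)
    fun k => s (k - 1) = s k
  rw [hcard, Nat.card_Icc, add_tsub_cancel_right] at hcount
  rw [← Finset.prod_filter_mul_prod_filter_not _ fun k => s (k - 1) = s k, IY]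
  congr 1
  · have hneg : ∀ k ∈ (Finset.Icc 1 n).filter fun k => s (k - 1) = s k, sizeFactor n s k = -1 :=
      fun k hk => if_pos (Finset.mem_filter.1 hk).2
    rw [Finset.prod_congr rfl hneg, Finset.prod_const]
    generalize hc : (sC n fun i => s (n + 1 - i)) = c at hcount
    rw [show n + c = ((Finset.Icc 1 n).filter fun k => s (k - 1) = s k).card + (c + c) by omega,
      pow_add, Even.neg_one_pow ⟨_, rfl⟩, mul_one]
  · symm
    refine Finset.prod_nbij (fun r => n + 1 - iC n (fun i => s (n + 1 - i)) r) ?_ ?_ ?_ ?_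
    · intro r hr
      rw [Finset.mem_Icc] at hr
      have h := mem_cornerL.1 (iC_mem hr.1 hr.2)
      simp only [lamE_reverse h0] at h
      simp only [Finset.mem_filter, Finset.mem_Icc]
      refine ⟨by omega, ?_⟩
      rw [show ∀ i, n + 1 - i - 1 = n + 1 - (i + 1) from fun i => by omega]
      exact h.2.ne
    · intro r hr t ht h
      simp only [Finset.coe_Icc, Set.mem_Icc] at hr ht
      have h1 := (mem_cornerL.1 (iC_mem hr.1 hr.2)).1
      have h2 := (mem_cornerL.1 (iC_mem ht.1 ht.2)).1
      rcases lt_trichotomy r t with h3 | h3 | h3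
      · have := iC_lt_iC h3 (ht.2.trans (Nat.le_succ _))
        dsimp only at h
        omega
      · exact h3
      · have := iC_lt_iC h3 (hr.2.trans (Nat.le_succ _))
        dsimp only at h
        omega
    · intro k hk
      simp only [Finset.coe_filter, Finset.mem_Icc, Set.mem_ofPred_eq] at hk
      have := hs (k - 1) k (by omega) (by omega)
      have hmem : n + 1 - k ∈ cornerL n fun i => s (n + 1 - i) := by
        rw [mem_cornerL, lamE_reverse h0, lamE_reverse h0,
          show n + 1 - (n + 1 - k + 1) = k - 1 by omega, show n + 1 - (n + 1 - k) = k by omega]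
        omega
      obtain ⟨r, h1, h2, h3⟩ := exists_iC_eq hmem
      refine ⟨r, by simp [h1, h2], ?_⟩
      dsimp only
      omega
    · intro r hr
      rw [Finset.mem_Icc] at hr
      exact yC_reverse h0 hs hr.1 hr.2

theorem IY_congr {lam lam' : ℕ → ℕ} (h : ∀ i, 1 ≤ i → i ≤ n → lam i = lam' i) :
    IY n lam = IY n lam' := by
  have hE : ∀ i, 1 ≤ i → lamE n lam i = lamE n lam' i := fun i hi => by
    rw [lamE, lamE]
    split_ifs with hin
    · exact h i hi hin
    · rfl
  have hL : cornerL n lam = cornerL n lam' := by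
    rw [cornerL, cornerL]
    congr 1
    refine Finset.filter_congr fun i hi => ?_
    rw [hE _ (Finset.mem_Icc.1 hi).1, hE _ (Nat.le_add_left 1 i)]
  have hs : sC n lam = sC n lam' := by rw [sC, sC, hL]
  have hi : iC n lam = iC n lam' := by
    funext r
    rw [iC, iC, hL]
  rw [IY, IY, hs]
  congr 1
  refine Finset.prod_congr rfl fun r hr => ?_
  rw [Finset.mem_Icc, ← hs] at hr
  have h1 := iC_lt_iC (n := n) (lam := lam) (r := 0) (t := r) hr.1 (by omega)
  have h2 := iC_lt_iC (n := n) (lam := lam) (r := 0) (t := r + 1) (by omega) (by omega)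
  rw [yC, yC, aC, aC, bC, bC, cC, cC, ← hi, hE _ (by omega), hE _ (by omega)]

end Conversion

/-- For a chain `S_1 ⊆ … ⊆ S_n` of admissible subsets of `[±n]`, with
`λ_i = |S_{n+1−i}|` and `m = #{i : λ_i = n}`, one has
`τ_{S_1} ⋯ τ_{S_n} = 2^{n−λ_1+m−1} I(λ) · τ_{{1}} ⋯ τ_{{1,…,n}}` in `R^C_n`. -/
theorem typeC_intersection_formula (n : ℕ) (hn : 1 ≤ n)
    (S : ℕ → Finset (PM n))
    (hadm : ∀ i ∈ Finset.Icc 1 n, Adm n (S i))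
    (hchain : ∀ i j, 1 ≤ i → i ≤ j → j ≤ n → S i ⊆ S j) :
    (∏ i ∈ Finset.Icc 1 n, tauC n (S i)) =
      ((2 ^ (n - (S n).card + ((Finset.Icc 1 n).filter (fun i => (S i).card = n)).card - 1) *
          IY n (fun i => (S (n + 1 - i)).card) : ℤ) : RC n) * ptC n := by
  have hS : IsAdmChain n (Function.update S 0 ∅) :=
    { zero := Function.update_self _ _ _
      adm := fun i hi => by
        rw [Function.update_of_ne (by have := (Finset.mem_Icc.1 hi).1; omega)]
        exact hadm i hi
      mono := fun i j hij hj => by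
        rcases Nat.eq_zero_or_pos i with rfl | hi
        · rw [Function.update_self]
          exact Finset.empty_subset _
        · rw [Function.update_of_ne (by omega), Function.update_of_ne (by omega)]
          exact hchain i j hi hij hj }
  have hne : ∀ k, 1 ≤ k → Function.update S 0 ∅ k = S k :=
    fun k hk => Function.update_of_ne (by omega) _ _
  have hprod := hS.prod_tauC_eq hn
  rw [Finset.prod_congr rfl fun k hk => by rw [hne k (Finset.mem_Icc.1 hk).1]] at hprod
  rw [hprod, sizeNumber, twoExp, hne n hn,
    Finset.filter_congr fun k hk => by rw [hne k (Finset.mem_Icc.1 hk).1],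
    prod_sizeFactor_eq_IY (by rw [hS.zero, Finset.card_empty])
      fun a b hab hb => Finset.card_le_card (hS.mono a b hab hb),
    IY_congr fun i _ hin => by rw [hne (n + 1 - i) (by omega)]]
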